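/- There is an absolute constant c such that every graph H that is a disjoint union of cycles satisfies: every graph of treewidth at least c·|V(H)|·(log₂ |V(H)|)² contains H as a minor. -/

import Mathlib

open SimpleGraph
variable {V : Type}

/-- `G` has a tree decomposition of width at most `w`. -/
def HasTreeDecompWidth (G : SimpleGraph V) (w : ℕ) : Prop :=
  ∃ (ι : Type) (T : SimpleGraph ι) (bag : ι → Set V),
    T.IsTree ∧
    (∀ v, ∃ i, v ∈ bag i) ∧
    (∀ u v, G.Adj u v → ∃ i, u ∈ bag i ∧ v ∈ bag i) ∧
    (∀ v, (T.induce {i | v ∈ bag i}).Connected) ∧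
    (∀ i, (bag i).Finite ∧ (bag i).ncard ≤ w + 1)

/-- The treewidth of `G`. -/
noncomputable def treewidth (G : SimpleGraph V) : ℕ := sInf {w | HasTreeDecompWidth G w}

/-- `H` is a minor of `G`, via branch sets. -/
def IsMinor {W : Type*} (H : SimpleGraph W) (G : SimpleGraph V) : Prop :=
  ∃ φ : W → Set V, (∀ w, (φ w).Nonempty ∧ (G.induce (φ w)).Connected) ∧
    (∀ w w', w ≠ w' → Disjoint (φ w) (φ w')) ∧
    (∀ w w', H.Adj w w' → ∃ u ∈ φ w, ∃ v ∈ φ w', G.Adj u v)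

/-- `H` is the disjoint union of `r` cycles, each of length at most `ℓ`. -/
def IsDisjointUnionOfCycles {W : Type*} (H : SimpleGraph W) (r ℓ : ℕ) : Prop :=
  ∃ f : Fin r → Σ v, H.Walk v v,
    (∀ i, (f i).2.IsCycle ∧ (f i).2.length ≤ ℓ) ∧
    (∀ i j, i ≠ j → ∀ x ∈ (f i).2.support, x ∉ (f j).2.support) ∧
    (∀ w : W, ∃ i, w ∈ (f i).2.support) ∧
    (∀ e ∈ H.edgeSet, ∃ i, e ∈ (f i).2.edges)


/-! ### Connected vertex sets -/

/-- A vertex set is connected: nonempty and every subset closed under adjacency is everything. -/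
def SConn {V : Type} (G : SimpleGraph V) (S : Set V) : Prop :=
  S.Nonempty ∧ ∀ Y : Set V, (S ∩ Y).Nonempty → (∀ u ∈ S, u ∈ Y → ∀ v ∈ S, G.Adj u v → v ∈ Y) → S ⊆ Y

theorem sconn_iff {V : Type} (G : SimpleGraph V) (S : Set V) :
    SConn G S ↔ (G.induce S).Connected := by
  constructor
  · rintro ⟨⟨x, hx⟩, h⟩
    have : Nonempty S := ⟨⟨x, hx⟩⟩
    refine SimpleGraph.Connected.mk ?_
    rintro ⟨a, ha⟩ ⟨b, hb⟩
    have := h {y | ∃ hy : y ∈ S, (G.induce S).Reachable ⟨a, ha⟩ ⟨y, hy⟩} ⟨a, ha, ha, .refl _⟩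
      (by
        rintro u hu ⟨hu', hr⟩ v hv huv
        refine ⟨hv, hr.trans ?_⟩
        exact SimpleGraph.Adj.reachable (by simpa using huv))
    obtain ⟨_, h⟩ := this hb
    exact h
  · intro h
    obtain ⟨⟨x, hx⟩⟩ := h.nonempty
    refine ⟨⟨x, hx⟩, ?_⟩
    rintro Y ⟨a, ha, haY⟩ hcl b hb
    by_contra hbY
    obtain ⟨p⟩ := h.preconnected ⟨a, ha⟩ ⟨b, hb⟩
    obtain ⟨d, -, h1, h2⟩ := p.exists_boundary_dart {y | y.1 ∈ Y} haY hbY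
    exact h2 (hcl d.fst.1 d.fst.2 h1 d.snd.1 d.snd.2 (by simpa using d.adj))

theorem SConn.singleton {V : Type} (G : SimpleGraph V) (v : V) : SConn G {v} := by
  refine ⟨⟨v, rfl⟩, ?_⟩
  rintro Y ⟨a, rfl, ha⟩ - b rfl
  exact ha

theorem SConn.union {V : Type} {G : SimpleGraph V} {S T : Set V} (hS : SConn G S) (hT : SConn G T)
    (h : (∃ x ∈ S, x ∈ T) ∨ ∃ x ∈ S, ∃ y ∈ T, G.Adj x y) : SConn G (S ∪ T) := by
  refine ⟨hS.1.inl, ?_⟩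
  rintro Y ⟨a, ha, haY⟩ hcl
  have kS : ∀ z ∈ S, z ∈ Y → S ⊆ Y := fun z hz hzY => hS.2 Y ⟨z, hz, hzY⟩
    (fun u hu huY v hv => hcl u (Or.inl hu) huY v (Or.inl hv))
  have kT : ∀ z ∈ T, z ∈ Y → T ⊆ Y := fun z hz hzY => hT.2 Y ⟨z, hz, hzY⟩
    (fun u hu huY v hv => hcl u (Or.inr hu) huY v (Or.inr hv))
  have hST : S ⊆ Y → T ⊆ Y := by
    intro hs
    rcases h with ⟨x, hx, hx'⟩ | ⟨x, hx, y, hy, hxy⟩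
    · exact kT x hx' (hs hx)
    · exact kT y hy (hcl x (Or.inl hx) (hs hx) y (Or.inr hy) hxy)
  have hTS : T ⊆ Y → S ⊆ Y := by
    intro hs
    rcases h with ⟨x, hx, hx'⟩ | ⟨x, hx, y, hy, hxy⟩
    · exact kS x hx (hs hx')
    · exact kS x hx (hcl y (Or.inr hy) (hs hy) x (Or.inl hx) hxy.symm)
  rcases ha with ha | ha
  · have := kS a ha haY
    exact Set.union_subset this (hST this)
  · have := kT a ha haY
    exact Set.union_subset (hTS this) this

/-- Crossing lemma. -/
theorem SConn.cross {V : Type} {G : SimpleGraph V} {S : Set V} (hS : SConn G S) (Y : Set V)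
    {a b : V} (ha : a ∈ S) (haY : a ∈ Y) (hb : b ∈ S) (hbY : b ∉ Y) :
    ∃ u ∈ S, u ∈ Y ∧ ∃ v ∈ S, v ∉ Y ∧ G.Adj u v := by
  by_contra hcon
  push Not at hcon
  exact hbY (hS.2 Y ⟨a, ha, haY⟩ (fun u hu huY v hv huv => by
    by_contra hvY
    exact hcon u hu huY v hv hvY huv) hb)

theorem SConn.mono {V : Type} {G G' : SimpleGraph V} (h : G ≤ G') {S : Set V} (hS : SConn G S) :
    SConn G' S :=
  ⟨hS.1, fun Y hY hcl => hS.2 Y hY (fun u hu huY v hv huv => hcl u hu huY v hv (h huv))⟩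

theorem SConn.exists_path {V : Type} {G : SimpleGraph V} {S : Set V} (hS : SConn G S)
    {a b : V} (ha : a ∈ S) (hb : b ∈ S) :
    ∃ p : G.Walk a b, p.IsPath ∧ ∀ x ∈ p.support, x ∈ S := by
  classical
  rw [sconn_iff] at hS
  obtain ⟨p⟩ := hS.preconnected ⟨a, ha⟩ ⟨b, hb⟩
  let q : G.Walk a b := p.map (SimpleGraph.Embedding.induce S).toHom
  refine ⟨q.bypass, q.bypass_isPath, fun x hx => ?_⟩
  have h1 : x ∈ q.support := q.support_bypass_subset_support hx
  have h2 : q.support = p.support.map (SimpleGraph.Embedding.induce S).toHom :=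
    SimpleGraph.Walk.support_map _ _
  rw [h2, List.mem_map] at h1
  obtain ⟨y, -, rfl⟩ := h1
  exact y.2

theorem SConn.of_walk {V : Type} {G : SimpleGraph V} {a b : V} (p : G.Walk a b) :
    SConn G {x | x ∈ p.support} := by
  rw [sconn_iff]
  exact p.connected_induce_support

/-- Indexed union along a root. -/
theorem SConn.iUnion_of_root {V : Type} {G : SimpleGraph V} {S : Set V} (r : V) (hr : r ∈ S)
    (h : ∀ x ∈ S, ∃ T ⊆ S, r ∈ T ∧ x ∈ T ∧ SConn G T) : SConn G S := by
  refine ⟨⟨r, hr⟩, ?_⟩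
  rintro Y ⟨a, ha, haY⟩ hcl
  have key : ∀ T ⊆ S, SConn G T → ∀ z ∈ T, z ∈ Y → T ⊆ Y := fun T hT hc z hz hzY =>
    hc.2 Y ⟨z, hz, hzY⟩ (fun u hu huY v hv => hcl u (hT hu) huY v (hT hv))
  obtain ⟨T, hT, hrT, haT, hc⟩ := h a ha
  have hrY : r ∈ Y := key T hT hc a haT haY hrT
  intro x hx
  obtain ⟨T, hT, hrT, hxT, hc⟩ := h x hx
  exact key T hT hc r hrT hrY hxT

/-- A consecutive chain of adjacent vertices is connected. -/
theorem SConn.chain {V : Type} {G : SimpleGraph V} (f : ℕ → V) (a b : ℕ) (hab : a ≤ b)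
    (h : ∀ i, a ≤ i → i < b → G.Adj (f i) (f (i + 1))) :
    SConn G {x | ∃ i, a ≤ i ∧ i ≤ b ∧ f i = x} := by
  induction b, hab using Nat.le_induction with
  | base =>
    have : {x | ∃ i, a ≤ i ∧ i ≤ a ∧ f i = x} = {f a} := by
      ext x; constructor
      · rintro ⟨i, h1, h2, rfl⟩
        have : i = a := le_antisymm h2 h1
        simp [this]
      · rintro rfl; exact ⟨a, le_rfl, le_rfl, rfl⟩
    rw [this]; exact SConn.singleton _ _
  | succ b hb ih =>
    have ih' := ih (fun i h1 h2 => h i h1 (by omega))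
    have := ih'.union (SConn.singleton G (f (b+1)))
      (Or.inr ⟨f b, ⟨b, hb, le_rfl, rfl⟩, _, rfl, h b hb (by omega)⟩)
    convert this using 1
    ext x; constructor
    · rintro ⟨i, h1, h2, rfl⟩
      rcases Nat.lt_or_ge i (b+1) with h3 | h3
      · exact Or.inl ⟨i, h1, by omega, rfl⟩
      · right
        have : i = b+1 := by omega
        simp [this]
    · rintro (⟨i, h1, h2, rfl⟩ | rfl)
      · exact ⟨i, h1, by omega, rfl⟩
      · exact ⟨b+1, by omega, le_rfl, rfl⟩


/-! ### Tree decompositions from balanced separators -/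

theorem SConn.map {V V' : Type} {G : SimpleGraph V} {G' : SimpleGraph V'} (f : V → V')
    (hf : ∀ a b, G.Adj a b → G'.Adj (f a) (f b)) {S : Set V} (hS : SConn G S) :
    SConn G' (f '' S) := by
  refine ⟨hS.1.image f, ?_⟩
  rintro Y ⟨_, ⟨a, ha, rfl⟩, haY⟩ hcl
  have := hS.2 (f ⁻¹' Y) ⟨a, ha, haY⟩
    (fun u hu huY v hv huv => hcl _ ⟨u, hu, rfl⟩ huY _ ⟨v, hv, rfl⟩ (hf _ _ huv))
  exact Set.image_subset_iff.2 this

theorem isTree_sum {ι₁ ι₂ : Type} [Fintype ι₁] [Fintype ι₂] (T₁ : SimpleGraph ι₁)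
    (T₂ : SimpleGraph ι₂) (h₁ : T₁.IsTree) (h₂ : T₂.IsTree) (r₁ : ι₁) (r₂ : ι₂) :
    ((T₁ ⊕g T₂) ⊔ SimpleGraph.edge (Sum.inl r₁) (Sum.inr r₂)).IsTree := by
  classical
  rw [isTree_iff_connected_and_card] at h₁ h₂ ⊢
  refine ⟨h₁.1.sum_sup_edge h₂.1, ?_⟩
  have he : ((T₁ ⊕g T₂) ⊔ SimpleGraph.edge (Sum.inl r₁) (Sum.inr r₂)).edgeSet =
      insert s(Sum.inl r₁, Sum.inr r₂) (T₁ ⊕g T₂).edgeSet := by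
    rw [edgeSet_sup, edgeSet_edge_of_ne (by simp), Set.union_comm]; rfl
  rw [he, Nat.card_coe_set_eq, Set.ncard_insert_of_notMem (by simp), ← Nat.card_coe_set_eq,
    Nat.card_congr edgeSetSumEquiv, Nat.card_sum, Nat.card_sum]
  omega

/-- A rooted tree decomposition of `G[U]` with root bag `X` and all bags of size at most `m`. -/
def TD {V : Type} (G : SimpleGraph V) (U X : Finset V) (m : ℕ) : Prop :=
  ∃ (ι : Type) (_ : Fintype ι) (T : SimpleGraph ι) (bag : ι → Finset V) (r : ι),
    T.IsTree ∧ (∀ v ∈ U, ∃ i, v ∈ bag i) ∧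
    (∀ u ∈ U, ∀ v ∈ U, G.Adj u v → ∃ i, u ∈ bag i ∧ v ∈ bag i) ∧
    (∀ v ∈ U, SConn T {i | v ∈ bag i}) ∧
    (∀ i, bag i ⊆ U) ∧ (∀ i, (bag i).card ≤ m) ∧ bag r = X

theorem TD.single {V : Type} (G : SimpleGraph V) (U : Finset V) (m : ℕ) (h : U.card ≤ m) :
    TD G U U m := by
  refine ⟨Unit, inferInstance, ⊥, fun _ => U, (), ?_, ?_, ?_, ?_, ?_, ?_, rfl⟩
  · exact IsTree.of_subsingleton
  · exact fun v hv => ⟨(), hv⟩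
  · exact fun u hu v hv _ => ⟨(), hu, hv⟩
  · intro v hv
    have : {i : Unit | v ∈ U} = {()} := by ext; simp [hv]
    rw [this]; exact SConn.singleton _ _
  · exact fun _ => Finset.Subset.refl _
  · exact fun _ => h

theorem TD.join {V : Type} [DecidableEq V] {G : SimpleGraph V} {U₁ U₂ X₁ X₂ : Finset V} {m : ℕ}
    (h₁ : TD G U₁ X₁ m) (h₂ : TD G U₂ X₂ m) (hU : U₁ ∩ U₂ ⊆ X₁ ∩ X₂)
    (hE : ∀ u ∈ U₁, u ∉ U₂ → ∀ v ∈ U₂, v ∉ U₁ → ¬ G.Adj u v) :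
    TD G (U₁ ∪ U₂) X₁ m := by
  obtain ⟨ι₁, _, T₁, bag₁, r₁, t₁, c₁, e₁, k₁, s₁, m₁, b₁⟩ := h₁
  obtain ⟨ι₂, _, T₂, bag₂, r₂, t₂, c₂, e₂, k₂, s₂, m₂, b₂⟩ := h₂
  refine ⟨ι₁ ⊕ ι₂, inferInstance, (T₁ ⊕g T₂) ⊔ SimpleGraph.edge (Sum.inl r₁) (Sum.inr r₂),
    Sum.elim bag₁ bag₂, Sum.inl r₁, isTree_sum _ _ t₁ t₂ _ _, ?_, ?_, ?_, ?_, ?_, ?_⟩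
  · intro v hv
    rcases Finset.mem_union.1 hv with hv | hv
    · obtain ⟨i, hi⟩ := c₁ v hv; exact ⟨Sum.inl i, hi⟩
    · obtain ⟨i, hi⟩ := c₂ v hv; exact ⟨Sum.inr i, hi⟩
  · intro u hu v hv huv
    have a₁ : u ∈ U₁ → v ∈ U₁ → ∃ i, u ∈ Sum.elim bag₁ bag₂ i ∧ v ∈ Sum.elim bag₁ bag₂ i :=
      fun hu hv => by obtain ⟨i, hi⟩ := e₁ u hu v hv huv; exact ⟨Sum.inl i, hi⟩
    have a₂ : u ∈ U₂ → v ∈ U₂ → ∃ i, u ∈ Sum.elim bag₁ bag₂ i ∧ v ∈ Sum.elim bag₁ bag₂ i :=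
      fun hu hv => by obtain ⟨i, hi⟩ := e₂ u hu v hv huv; exact ⟨Sum.inr i, hi⟩
    have b := hE u
    have b' := hE v
    have := huv.symm
    rw [Finset.mem_union] at hu hv
    by_cases u ∈ U₁ <;> by_cases v ∈ U₁ <;> by_cases u ∈ U₂ <;> by_cases v ∈ U₂ <;> grind
  · intro v hv
    have hs : {i | v ∈ Sum.elim bag₁ bag₂ i} =
        (Sum.inl '' {i | v ∈ bag₁ i}) ∪ (Sum.inr '' {i | v ∈ bag₂ i}) := by
      ext i; cases i <;> simp
    rw [hs]
    have n₁ : v ∉ U₁ → {i | v ∈ bag₁ i} = ∅ := by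
      intro h; ext i; simp only [Set.mem_ofPred_eq, Set.mem_empty_iff_false, iff_false]
      exact fun hi => h (s₁ i hi)
    have n₂ : v ∉ U₂ → {i | v ∈ bag₂ i} = ∅ := by
      intro h; ext i; simp only [Set.mem_ofPred_eq, Set.mem_empty_iff_false, iff_false]
      exact fun hi => h (s₂ i hi)
    have q₁ : v ∈ U₁ → SConn ((T₁ ⊕g T₂) ⊔ SimpleGraph.edge (Sum.inl r₁) (Sum.inr r₂))
        (Sum.inl '' {i | v ∈ bag₁ i}) := fun h => (k₁ v h).map _ (fun a b hab => by
          left; exact sum_adj_inl.2 hab)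
    have q₂ : v ∈ U₂ → SConn ((T₁ ⊕g T₂) ⊔ SimpleGraph.edge (Sum.inl r₁) (Sum.inr r₂))
        (Sum.inr '' {i | v ∈ bag₂ i}) := fun h => (k₂ v h).map _ (fun a b hab => by
          left; exact sum_adj_inr.2 hab)
    by_cases v₁ : v ∈ U₁ <;> by_cases v₂ : v ∈ U₂
    · refine (q₁ v₁).union (q₂ v₂) (Or.inr ⟨Sum.inl r₁, ⟨r₁, ?_, rfl⟩, Sum.inr r₂, ⟨r₂, ?_, rfl⟩, ?_⟩)
      · have := hU (Finset.mem_inter.2 ⟨v₁, v₂⟩)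
        simp only [Set.mem_ofPred_eq, b₁]; exact (Finset.mem_inter.1 this).1
      · have := hU (Finset.mem_inter.2 ⟨v₁, v₂⟩)
        simp only [Set.mem_ofPred_eq, b₂]; exact (Finset.mem_inter.1 this).2
      · right
        rw [SimpleGraph.edge_adj]
        simp
    · rw [n₂ v₂]; simpa using q₁ v₁
    · rw [n₁ v₁]; simpa using q₂ v₂
    · simp [v₁, v₂] at hv
  · rintro (i | i)
    · exact (s₁ i).trans Finset.subset_union_left
    · exact (s₂ i).trans Finset.subset_union_right
  · rintro (i | i)
    · exact m₁ i
    · exact m₂ i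
  · exact b₁

theorem TD.of_separators {V : Type} [Fintype V] [DecidableEq V] (G : SimpleGraph V) (k : ℕ)
    (hk : 0 < k)
    (h : ∀ Z : Finset V, Z.card = 8 * k → ∃ S A B : Finset V, (∀ v, v ∈ S ∨ v ∈ A ∨ v ∈ B) ∧
      Disjoint A B ∧ Disjoint A S ∧ Disjoint B S ∧ S.card ≤ k ∧
      (∀ u ∈ A, ∀ v ∈ B, ¬ G.Adj u v) ∧ (A ∩ Z).card ≤ 6 * k ∧ (B ∩ Z).card ≤ 6 * k) :
    ∀ (N : ℕ) (U Z : Finset V), U.card ≤ N → Z ⊆ U → Z.card ≤ 8 * k →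
      ∃ X, Z ⊆ X ∧ TD G U X (9 * k) := by
  intro N
  induction N with
  | zero =>
    intro U Z hU hZ hZc
    exact ⟨U, hZ, TD.single _ _ _ (by omega)⟩
  | succ N ih =>
    intro U Z hU hZ hZc
    by_cases hsmall : U.card ≤ 8 * k
    · exact ⟨U, hZ, TD.single _ _ _ (by omega)⟩
    obtain ⟨Z', hZZ', hZ'U, hZ'c⟩ := Finset.exists_subsuperset_card_eq hZ hZc (by omega : 8 * k ≤ U.card)
    obtain ⟨S, A, B, hcov, hAB, hAS, hBS, hSc, hno, hA, hB⟩ := h Z' hZ'c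
    rw [Finset.disjoint_left] at hAB hAS hBS
    have aux : ∀ A B : Finset V, (∀ v ∈ A, v ∉ B) → (∀ v ∈ A, v ∉ S) → (A ∩ Z').card ≤ 6 * k →
        ∃ X, (A ∩ Z') ∪ (S ∩ U) ⊆ X ∧ TD G ((A ∪ S) ∩ U) X (9 * k) := by
      intro A B hAB hAS hA
      apply ih
      · have : ((A ∪ S) ∩ U) ⊂ U := by
          refine Finset.ssubset_iff_subset_ne.2 ⟨Finset.inter_subset_right, fun heq => ?_⟩
          have h1 : Z' ⊆ (A ∩ Z') ∪ S := by
            intro z hz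
            have := hZ'U hz
            rw [← heq] at this
            grind
          have := (Finset.card_le_card h1).trans (Finset.card_union_le _ _)
          omega
        have := Finset.card_lt_card this
        omega
      · intro z; grind
      · have := Finset.card_union_le (A ∩ Z') (S ∩ U)
        have := Finset.card_le_card (Finset.inter_subset_left : S ∩ U ⊆ S)
        omega
    obtain ⟨X₁, hX₁, t₁⟩ := aux A B hAB hAS hA
    obtain ⟨X₂, hX₂, t₂⟩ := aux B A (fun v hv hv' => hAB hv' hv) hBS hB
    have t₀ : TD G (Z' ∪ (S ∩ U)) (Z' ∪ (S ∩ U)) (9 * k) := by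
      apply TD.single
      have := Finset.card_union_le Z' (S ∩ U)
      have := Finset.card_le_card (Finset.inter_subset_left : S ∩ U ⊆ S)
      omega
    have t₃ := (t₀.join t₁ (by
      intro v hv
      have hx := @hX₁ v
      simp only [Finset.mem_union, Finset.mem_inter] at hv hx ⊢
      tauto) (by
      intro u hu hu' v hv hv' huv
      have h1 := hcov u
      have h2 := hcov v
      have := @hZ'U u
      have := hno v
      have := huv.symm
      simp only [Finset.mem_union, Finset.mem_inter] at hu hu' hv hv'
      grind)).join t₂ (by
      intro v hv
      have hx := @hX₂ v
      have h1 := @hAB v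
      have h2 := @hBS v
      simp only [Finset.mem_union, Finset.mem_inter] at hv hx ⊢
      tauto) (by
      intro u hu hu' v hv hv' huv
      have h1 := hcov u
      have h2 := hcov v
      have := @hZ'U u
      have := @hZ'U v
      have := hno u
      simp only [Finset.mem_union, Finset.mem_inter] at hu hu' hv hv'
      grind)
    refine ⟨Z' ∪ (S ∩ U), hZZ'.trans Finset.subset_union_left, ?_⟩
    convert t₃ using 1
    ext v
    have h1 := hcov v
    have := @hZ'U v
    simp only [Finset.mem_union, Finset.mem_inter]
    tauto

theorem TD.hasWidth {V : Type} [Fintype V] {G : SimpleGraph V} {X : Finset V} {m : ℕ}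
    (h : TD G Finset.univ X (m + 1)) : HasTreeDecompWidth G m := by
  obtain ⟨ι, _, T, bag, r, t, c, e, k, s, m, b⟩ := h
  refine ⟨ι, T, fun i => (bag i : Set V), t, ?_, ?_, ?_, ?_⟩
  · exact fun v => c v (Finset.mem_univ _)
  · exact fun u v huv => e u (Finset.mem_univ _) v (Finset.mem_univ _) huv
  · intro v
    exact (sconn_iff _ _).1 (k v (Finset.mem_univ _))
  · intro i
    refine ⟨Finset.finite_toSet _, ?_⟩
    rw [Set.ncard_coe_finset]
    exact m i

/-- A haven of order `k`. -/
def IsHaven {V : Type} (G : SimpleGraph V) (k : ℕ) (β : Finset V → Set V) : Prop :=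
  (∀ S : Finset V, S.card ≤ k → SConn G (β S) ∧ (∀ v ∈ β S, v ∉ S) ∧
    ∀ u ∈ β S, ∀ v, G.Adj u v → v ∉ S → v ∈ β S) ∧
  ∀ S T : Finset V, S ⊆ T → T.card ≤ k → β T ⊆ β S

theorem exists_haven {V : Type} [Fintype V] (G : SimpleGraph V) (k : ℕ) (hk : 0 < k)
    (htw : 9 * k ≤ treewidth G) : ∃ β, IsHaven G k β := by
  classical
  by_cases h : ∀ Z : Finset V, Z.card = 8 * k → ∃ S A B : Finset V,
      (∀ v, v ∈ S ∨ v ∈ A ∨ v ∈ B) ∧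
      Disjoint A B ∧ Disjoint A S ∧ Disjoint B S ∧ S.card ≤ k ∧
      (∀ u ∈ A, ∀ v ∈ B, ¬ G.Adj u v) ∧ (A ∩ Z).card ≤ 6 * k ∧ (B ∩ Z).card ≤ 6 * k
  · exfalso
    obtain ⟨X, -, hX⟩ := TD.of_separators G k hk h _ Finset.univ ∅ le_rfl (by simp) (by simp)
    have h2 : HasTreeDecompWidth G (9 * k - 1) := by
      apply TD.hasWidth (X := X)
      rwa [Nat.sub_add_cancel (by omega)]
    have : treewidth G ≤ 9 * k - 1 := Nat.sInf_le h2
    omega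
  push Not at h
  obtain ⟨Z, hZ, hno⟩ := h
  -- closed majority sets
  let Good : Finset V → Finset V → Prop := fun S A =>
    (∀ v ∈ A, v ∉ S) ∧ (∀ u ∈ A, ∀ v, G.Adj u v → v ∉ S → v ∈ A) ∧ 4 * k < (A ∩ Z).card
  have hex : ∀ S : Finset V, S.card ≤ k → ∃ A, Good S A ∧ SConn G (A : Set V) := by
    intro S hS
    have hne : (Finset.univ.filter (fun A => Good S A)).Nonempty := by
      refine ⟨Finset.univ \ S, ?_⟩
      simp only [Finset.mem_filter, Finset.mem_univ, true_and]
      refine ⟨by simp, by simp, ?_⟩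
      have : Z ⊆ ((Finset.univ \ S) ∩ Z) ∪ S := by
        intro z hz; by_cases z ∈ S <;> simp_all
      have := (Finset.card_le_card this).trans (Finset.card_union_le _ _)
      omega
    obtain ⟨A, hA, hmin⟩ := Finset.exists_min_image _ Finset.card hne
    simp only [Finset.mem_filter, Finset.mem_univ, true_and] at hA hmin
    refine ⟨A, hA, ?_⟩
    obtain ⟨hA1, hA2, hA3⟩ := hA
    refine ⟨?_, ?_⟩
    · by_contra hemp
      have : A = ∅ := by
        rw [Set.not_nonempty_iff_eq_empty] at hemp; exact_mod_cast hemp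
      simp [this] at hA3
    · rintro Y ⟨y, hyA, hyY⟩ hcl
      by_contra hsub
      rw [Set.not_subset] at hsub
      obtain ⟨w, hwA, hwY⟩ := hsub
      let A₁ := A.filter (· ∈ Y)
      let A₂ := A.filter (· ∉ Y)
      have c₁ : A₁.card < A.card := Finset.card_lt_card
        (Finset.filter_ssubset.2 ⟨w, hwA, hwY⟩)
      have c₂ : A₂.card < A.card := Finset.card_lt_card
        (Finset.filter_ssubset.2 ⟨y, hyA, by simpa using hyY⟩)
      have cl₁ : (∀ v ∈ A₁, v ∉ S) ∧ (∀ u ∈ A₁, ∀ v, G.Adj u v → v ∉ S → v ∈ A₁) := by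
        refine ⟨fun v hv => hA1 v (Finset.mem_filter.1 hv).1, fun u hu v huv hvS => ?_⟩
        rw [Finset.mem_filter] at hu ⊢
        have := hA2 u hu.1 v huv hvS
        exact ⟨this, hcl u hu.1 hu.2 v this huv⟩
      have cl₂ : (∀ v ∈ A₂, v ∉ S) ∧ (∀ u ∈ A₂, ∀ v, G.Adj u v → v ∉ S → v ∈ A₂) := by
        refine ⟨fun v hv => hA1 v (Finset.mem_filter.1 hv).1, fun u hu v huv hvS => ?_⟩
        rw [Finset.mem_filter] at hu ⊢
        have := hA2 u hu.1 v huv hvS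
        exact ⟨this, fun hvY => hu.2 (hcl v this hvY u hu.1 huv.symm)⟩
      have s₁ : (A₁ ∩ Z).card ≤ 4 * k := by
        by_contra hc
        have := hmin A₁ ⟨cl₁.1, cl₁.2, by omega⟩
        omega
      have s₂ : (A₂ ∩ Z).card ≤ 4 * k := by
        by_contra hc
        have := hmin A₂ ⟨cl₂.1, cl₂.2, by omega⟩
        omega
      have hsum : (A₁ ∩ Z).card + (A₂ ∩ Z).card = (A ∩ Z).card := by
        rw [← Finset.card_union_of_disjoint]
        · congr 1; ext v; simp only [A₁, A₂, Finset.mem_union, Finset.mem_inter, Finset.mem_filter]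
          tauto
        · rw [Finset.disjoint_left]; intro v
          simp only [A₁, A₂, Finset.mem_inter, Finset.mem_filter]; tauto
      have fin : ∀ A' : Finset V, ((∀ v ∈ A', v ∉ S) ∧
          (∀ u ∈ A', ∀ v, G.Adj u v → v ∉ S → v ∈ A')) → (A' ∩ Z).card ≤ 4 * k →
          2 * k < (A' ∩ Z).card → False := by
        intro A' hcl' h1 h2
        have := hno S A' (Finset.univ \ (A' ∪ S)) (by
          intro v; simp only [Finset.mem_sdiff, Finset.mem_univ, Finset.mem_union]; tauto)
          (by rw [Finset.disjoint_left]; intro v; simp; tauto)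
          (by rw [Finset.disjoint_left]; exact hcl'.1)
          (by rw [Finset.disjoint_left]; intro v; simp) hS
          (by
            intro u hu v hv huv
            simp only [Finset.mem_sdiff, Finset.mem_univ, Finset.mem_union, true_and, not_or] at hv
            exact hv.1 (hcl'.2 u hu v huv hv.2)) (by omega)
        have h3 : (A' ∩ Z).card + ((Finset.univ \ (A' ∪ S)) ∩ Z).card ≤ Z.card := by
          rw [← Finset.card_union_of_disjoint]
          · apply Finset.card_le_card; intro v; simp only [Finset.mem_union, Finset.mem_inter]; tauto
          · rw [Finset.disjoint_left]; intro v; simp; tauto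
        omega
      rcases Nat.lt_or_ge (2 * k) (A₁ ∩ Z).card with h | h
      · exact fin A₁ cl₁ s₁ h
      · exact fin A₂ cl₂ s₂ (by omega)
  choose! β hβ using hex
  refine ⟨fun S => (β S : Set V), ?_, ?_⟩
  · intro S hS
    obtain ⟨⟨h1, h2, h3⟩, h4⟩ := hβ S hS
    exact ⟨h4, h1, h2⟩
  · intro S T hST hT
    obtain ⟨⟨h1, h2, h3⟩, h4⟩ := hβ S ((Finset.card_le_card hST).trans hT)
    obtain ⟨⟨g1, g2, g3⟩, g4⟩ := hβ T hT
    have : ((β S ∩ Z) ∩ (β T ∩ Z)).Nonempty := by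
      apply Finset.inter_nonempty_of_card_lt_card_add_card (s := Z)
        Finset.inter_subset_right Finset.inter_subset_right
      omega
    obtain ⟨z, hz⟩ := this
    simp only [Finset.mem_inter] at hz
    exact g4.2 (β S : Set V) ⟨z, hz.2.1, hz.1.1⟩
      (fun u hu huY v hv huv => h2 u huY v huv (fun hvS => g1 v hv (hST hvS)))


/-! ### The Menger theorem -/

/-- Every separation from `A` to `B` has order at least `k`. -/
def SepGE {V : Type} [DecidableEq V] (G : SimpleGraph V) (A B : Finset V) (k : ℕ) : Prop :=
  ∀ P Q : Finset V, A ⊆ P → B ⊆ Q → (∀ v, v ∈ P ∨ v ∈ Q) →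
    (∀ u v, G.Adj u v → (u ∈ P ∧ v ∈ P) ∨ (u ∈ Q ∧ v ∈ Q)) → k ≤ (P ∩ Q).card

/-- There are `k` disjoint connected sets each meeting `A` once and `B` once. -/
def Linked {V : Type} (G : SimpleGraph V) (A B : Finset V) (k : ℕ) : Prop :=
  ∃ (D : Fin k → Set V) (a b : Fin k → V), (∀ i, SConn G (D i)) ∧
    (∀ i j x, x ∈ D i → x ∈ D j → i = j) ∧
    (∀ i, a i ∈ D i ∧ a i ∈ A ∧ ∀ x ∈ D i, x ∈ A → x = a i) ∧
    (∀ i, b i ∈ D i ∧ b i ∈ B ∧ ∀ x ∈ D i, x ∈ B → x = b i)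

theorem Linked.glue {V : Type} [DecidableEq V] {G G₁ G₂ : SimpleGraph V} {A B P Q : Finset V}
    {k : ℕ} {x y : V} (hA : A ⊆ P) (hB : B ⊆ Q) (hxP : x ∈ P) (hxQ : x ∉ Q) (hyQ : y ∈ Q)
    (hyP : y ∉ P) (hxy : G.Adj x y)
    (hG₁ : G₁ ≤ G) (hG₂ : G₂ ≤ G) (hP : ∀ u v, G₁.Adj u v → v ∈ P)
    (hQ : ∀ u v, G₂.Adj u v → v ∈ Q)
    (hk : (P ∩ Q).card + 1 = k)
    (h₁ : Linked G₁ A (insert x (P ∩ Q)) k) (h₂ : Linked G₂ (insert y (P ∩ Q)) B k) :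
    Linked G A B k := by
  obtain ⟨D, a, d, hD, hDd, ha, hd⟩ := h₁
  obtain ⟨E, e, b, hE, hEd, he, hb⟩ := h₂
  have hDP : ∀ i, ∀ v ∈ D i, v ∈ P := fun i v hv =>
    (hD i).2 {v | v ∈ P} ⟨a i, (ha i).1, hA (ha i).2.1⟩ (fun u _ _ v _ huv => hP u v huv) hv
  have hEQ : ∀ i, ∀ v ∈ E i, v ∈ Q := fun i v hv =>
    (hE i).2 {v | v ∈ Q} ⟨b i, (hb i).1, hB (hb i).2.1⟩ (fun u _ _ v _ huv => hQ u v huv) hv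
  have heinj : Function.Injective e := fun i j hij => hEd i j (e i) (he i).1 (hij ▸ (he j).1)
  have hdinj : Function.Injective d := fun i j hij => hDd i j (d i) (hd i).1 (hij ▸ (hd j).1)
  have hyS : y ∉ P ∩ Q := by simp [hyP]
  have hxS : x ∉ P ∩ Q := by simp [hxQ]
  have himg : Finset.univ.image e = insert y (P ∩ Q) := by
    apply Finset.eq_of_subset_of_card_le
    · intro z hz
      obtain ⟨i, -, rfl⟩ := Finset.mem_image.1 hz
      exact (he i).2.1
    · rw [Finset.card_image_of_injective _ heinj, Finset.card_insert_of_notMem hyS]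
      simp [hk]
  have hsurj : ∀ z ∈ insert y (P ∩ Q), ∃ i, e i = z := by
    intro z hz
    rw [← himg] at hz
    simpa using hz
  have hσ : ∀ i, ∃ j, e j = if d i = x then y else d i := by
    intro i
    apply hsurj
    split_ifs with h
    · simp
    · have := (hd i).2.1
      rw [Finset.mem_insert] at this ⊢
      right
      exact this.resolve_left h
  choose σ hσ using hσ
  have hdx : ∀ i, d i ≠ y := by
    intro i h
    have := hDP i _ (hd i).1
    exact hyP (h ▸ this)
  have hσinj : Function.Injective σ := by
    intro i j hij
    apply hdinj
    have h1 := hσ i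
    have h2 := hσ j
    rw [hij, h2] at h1
    have h3 := hdx i
    have h4 := hdx j
    split_ifs at h1 with c1 c2 c2
    · exact c2.trans c1.symm
    · exact absurd h1.symm h3
    · exact absurd h1 h4
    · exact h1.symm
  -- an element in both D i and E (σ j)
  have hcommon : ∀ i j v, v ∈ D i → v ∈ E (σ j) → v = d i ∧ i = j := by
    intro i j v hv hv'
    have hvP := hDP i v hv
    have hvQ := hEQ _ v hv'
    have hS : v ∈ P ∩ Q := Finset.mem_inter.2 ⟨hvP, hvQ⟩
    have h1 := (hd i).2.2 v hv (Finset.mem_insert_of_mem hS)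
    have h2 := (he (σ j)).2.2 v hv' (Finset.mem_insert_of_mem hS)
    refine ⟨h1, hdinj ?_⟩
    rw [hσ] at h2
    split_ifs at h2 with h
    · exact absurd hvP (h2 ▸ hyP)
    · rw [← h1, h2]
  have hS' : ∀ i v, v ∈ E (σ i) → v ∈ P → v ∈ D i := by
    intro i v hv hvP
    have hvQ := hEQ _ v hv
    have hS : v ∈ P ∩ Q := Finset.mem_inter.2 ⟨hvP, hvQ⟩
    have h2 := (he (σ i)).2.2 v hv (Finset.mem_insert_of_mem hS)
    rw [hσ] at h2
    split_ifs at h2 with h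
    · exact absurd hvP (h2 ▸ hyP)
    · rw [h2]; exact (hd i).1
  have hS'' : ∀ i v, v ∈ D i → v ∈ Q → v ∈ E (σ i) := by
    intro i v hv hvQ
    have hvP := hDP _ v hv
    have hS : v ∈ P ∩ Q := Finset.mem_inter.2 ⟨hvP, hvQ⟩
    have h2 := (hd i).2.2 v hv (Finset.mem_insert_of_mem hS)
    have h3 := hσ i
    rw [if_neg] at h3
    · rw [h2, ← h3]; exact (he _).1
    · rintro h; exact hxQ (by rw [← h, ← h2]; exact hvQ)
  refine ⟨fun i => D i ∪ E (σ i), a, fun i => b (σ i), ?_, ?_, ?_, ?_⟩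
  · intro i
    refine ((hD i).mono hG₁).union ((hE _).mono hG₂) ?_
    have h3 := hσ i
    split_ifs at h3 with h
    · right
      exact ⟨x, h ▸ (hd i).1, y, h3 ▸ (he _).1, hxy⟩
    · left
      exact ⟨d i, (hd i).1, h3 ▸ (he _).1⟩
  · rintro i j v (hi | hi) (hj | hj)
    · exact hDd i j v hi hj
    · exact (hcommon i j v hi hj).2
    · exact (hcommon j i v hj hi).2.symm
    · exact hσinj (hEd _ _ v hi hj)
  · intro i
    refine ⟨Or.inl (ha i).1, (ha i).2.1, ?_⟩
    rintro v (hv | hv) hvA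
    · exact (ha i).2.2 v hv hvA
    · exact (ha i).2.2 v (hS' i v hv (hA hvA)) hvA
  · intro i
    refine ⟨Or.inr (hb _).1, (hb _).2.1, ?_⟩
    rintro v (hv | hv) hvB
    · exact (hb _).2.2 v (hS'' i v hv (hB hvB)) hvB
    · exact (hb _).2.2 v hv hvB

theorem menger {V : Type} [Fintype V] [DecidableEq V] (G : SimpleGraph V) :
    ∀ (A B : Finset V) (k : ℕ), SepGE G A B k → Linked G A B k := by
  induction G using WellFoundedLT.induction with
  | ind G ih =>
  intro A B k hsep
  by_cases hbot : G = ⊥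
  · subst hbot
    have := hsep A (Aᶜ ∪ B) subset_rfl Finset.subset_union_right
      (fun v => by simp only [Finset.mem_union, Finset.mem_compl]; tauto) (by simp)
    have h2 : A ∩ (Aᶜ ∪ B) = A ∩ B := by ext; simp; tauto
    rw [h2] at this
    obtain ⟨T, hT, hTc⟩ := Finset.exists_subset_card_eq this
    let f := T.equivFin.symm
    let g : Fin k → V := fun i => (f (i.cast hTc.symm)).1
    have hg : ∀ i, g i ∈ A ∩ B := fun i => hT (f _).2
    have hginj : Function.Injective g := by
      intro i j hij
      have := f.injective (Subtype.ext hij)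
      simpa using this
    refine ⟨fun i => {g i}, g, g, fun i => SConn.singleton _ _, ?_, ?_, ?_⟩
    · rintro i j x hx hx'
      simp only [Set.mem_singleton_iff] at hx hx'
      exact hginj (hx.symm.trans hx')
    · intro i
      exact ⟨rfl, (Finset.mem_inter.1 (hg i)).1, fun x hx _ => hx⟩
    · intro i
      exact ⟨rfl, (Finset.mem_inter.1 (hg i)).2, fun x hx _ => hx⟩
  obtain ⟨x₀, y₀, hxy₀⟩ : ∃ x y, G.Adj x y := by
    by_contra h
    push Not at h
    exact hbot (by ext u v; simp [h])
  set G' := G.deleteEdges {s(x₀, y₀)} with hG'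
  have hle : G' ≤ G := deleteEdges_le _
  have hlt : G' < G := by
    refine lt_of_le_of_ne hle ?_
    intro h
    have h1 : G'.Adj x₀ y₀ := h ▸ hxy₀
    rw [hG', deleteEdges_adj] at h1
    exact h1.2 rfl
  by_cases hs : SepGE G' A B k
  · obtain ⟨D, a, b, h1, h2⟩ := ih G' hlt A B k hs
    exact ⟨D, a, b, fun i => (h1 i).mono hle, h2⟩
  unfold SepGE at hs
  push Not at hs
  obtain ⟨P, Q, hA, hB, hcov, hedge, hcard⟩ := hs
  have hadj : ∀ u v, G.Adj u v → G'.Adj u v ∨ (u = x₀ ∧ v = y₀) ∨ (u = y₀ ∧ v = x₀) := by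
    intro u v huv
    by_cases h : s(u, v) = s(x₀, y₀)
    · right
      simpa using h
    · left
      rw [hG', deleteEdges_adj]
      exact ⟨huv, h⟩
  obtain ⟨x, y, hxy, hxQ, hyP, hed⟩ : ∃ x y, G.Adj x y ∧ x ∉ Q ∧ y ∉ P ∧
      ∀ u v, G.Adj u v → G'.Adj u v ∨ (u = x ∧ v = y) ∨ (u = y ∧ v = x) := by
    by_cases h1 : x₀ ∉ Q ∧ y₀ ∉ P
    · exact ⟨x₀, y₀, hxy₀, h1.1, h1.2, hadj⟩
    by_cases h2 : y₀ ∉ Q ∧ x₀ ∉ P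
    · exact ⟨y₀, x₀, hxy₀.symm, h2.1, h2.2, fun u v huv => by have := hadj u v huv; tauto⟩
    exfalso
    have := hsep P Q hA hB hcov (by
      intro u v huv
      have c1 := hcov x₀
      have c2 := hcov y₀
      rcases hadj u v huv with h | ⟨rfl, rfl⟩ | ⟨rfl, rfl⟩
      · exact hedge u v h
      · tauto
      · tauto)
    omega
  have hxP : x ∈ P := (hcov x).resolve_right hxQ
  have hyQ : y ∈ Q := (hcov y).resolve_left hyP
  have hk : (P ∩ Q).card + 1 = k := by
    have h1 := hsep P (insert x Q) hA (hB.trans (Finset.subset_insert _ _))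
      (fun v => by have := hcov v; simp only [Finset.mem_insert]; tauto) (by
      intro u v huv
      simp only [Finset.mem_insert]
      rcases hed u v huv with h | ⟨rfl, rfl⟩ | ⟨rfl, rfl⟩
      · have := hedge u v h
        tauto
      · tauto
      · tauto)
    have h2 : P ∩ insert x Q ⊆ insert x (P ∩ Q) := by
      intro z; simp only [Finset.mem_insert, Finset.mem_inter]; tauto
    have h3 := Finset.card_le_card h2
    have h4 := Finset.card_insert_le x (P ∩ Q)
    omega
  let GA : SimpleGraph V := ⟨fun u v => G'.Adj u v ∧ u ∈ P ∧ v ∈ P,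
    ⟨fun u v h => ⟨h.1.symm, h.2.2, h.2.1⟩⟩, ⟨fun u h => G'.loopless.irrefl u h.1⟩⟩
  let GB : SimpleGraph V := ⟨fun u v => G'.Adj u v ∧ u ∈ Q ∧ v ∈ Q,
    ⟨fun u v h => ⟨h.1.symm, h.2.2, h.2.1⟩⟩, ⟨fun u h => G'.loopless.irrefl u h.1⟩⟩
  have hGA : GA ≤ G' := fun u v h => h.1
  have hGB : GB ≤ G' := fun u v h => h.1
  refine Linked.glue (G₁ := GA) (G₂ := GB) hA hB hxP hxQ hyQ hyP hxy (hGA.trans hle) (hGB.trans hle)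
    (fun u v h => h.2.2) (fun u v h => h.2.2) hk ?_ ?_
  · apply ih GA (lt_of_le_of_lt hGA hlt)
    intro P' Q' hA' hB' hcov' hedge'
    have hxQ' : x ∈ Q' := hB' (by simp)
    have := hsep (P' ∩ P) ((Q' ∩ P) ∪ Q) (Finset.subset_inter hA' hA)
      (hB.trans Finset.subset_union_right)
      (fun v => by
        have := hcov v; have := hcov' v
        simp only [Finset.mem_union, Finset.mem_inter]; tauto) (by
      intro u v huv
      simp only [Finset.mem_union, Finset.mem_inter]
      rcases hed u v huv with h | ⟨rfl, rfl⟩ | ⟨rfl, rfl⟩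
      · rcases hedge u v h with h1 | h1
        · have := hedge' u v ⟨h, h1⟩
          tauto
        · tauto
      · tauto
      · tauto)
    refine this.trans (Finset.card_le_card ?_)
    intro v hv
    simp only [Finset.mem_union, Finset.mem_inter] at hv ⊢
    refine ⟨hv.1.1, ?_⟩
    rcases hv.2 with h | h
    · exact h.1
    · exact hB' (by simp [hv.1.2, h])
  · apply ih GB (lt_of_le_of_lt hGB hlt)
    intro P' Q' hA' hB' hcov' hedge'
    have hyP' : y ∈ P' := hA' (by simp)
    have := hsep ((P' ∩ Q) ∪ P) (Q' ∩ Q) 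
      (hA.trans Finset.subset_union_right) (Finset.subset_inter hB' hB)
      (fun v => by
        have := hcov v; have := hcov' v
        simp only [Finset.mem_union, Finset.mem_inter]; tauto) (by
      intro u v huv
      simp only [Finset.mem_union, Finset.mem_inter]
      rcases hed u v huv with h | ⟨rfl, rfl⟩ | ⟨rfl, rfl⟩
      · rcases hedge u v h with h1 | h1
        · tauto
        · have := hedge' u v ⟨h, h1⟩
          tauto
      · tauto
      · tauto)
    refine this.trans (Finset.card_le_card ?_)
    intro v hv
    simp only [Finset.mem_union, Finset.mem_inter] at hv ⊢
    refine ⟨?_, hv.2.1⟩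
    rcases hv.1 with h | h
    · exact h.1
    · exact hA' (by simp [hv.2.2, h])


/-! ### Long well-linked paths -/

theorem IsHaven.adj_next {V : Type} [DecidableEq V] {G : SimpleGraph V} {k : ℕ}
    {β : Finset V → Set V} (h : IsHaven G k β) {S : Finset V} {u : V} (hu : u ∈ β S)
    (hS : S.card + 1 ≤ k) : ∃ z ∈ β (insert u S), G.Adj u z := by
  have hc : (insert u S).card ≤ k := (Finset.card_insert_le _ _).trans hS
  obtain ⟨hconn, hav, hcl⟩ := h.1 (insert u S) hc
  obtain ⟨hconn', hav', hcl'⟩ := h.1 S (by omega)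
  have hsub := h.2 S (insert u S) (Finset.subset_insert _ _) hc
  obtain ⟨a, ha⟩ := hconn.1
  have huN : u ∉ β (insert u S) := fun h => hav u h (by simp)
  obtain ⟨x, hx, hxY, y, hy, hyY, hxy⟩ := hconn'.cross (β (insert u S)) (hsub ha) ha hu huN
  have : y ∈ insert u S := by
    by_contra hcon
    exact hyY (hcl x hxY y hxy hcon)
  rcases Finset.mem_insert.1 this with rfl | h1
  · exact ⟨x, hxY, hxy.symm⟩
  · exact absurd h1 (hav' y hy)

/-- The state of the path-growing procedure. -/
def PState {V : Type} (G : SimpleGraph V) (β : Finset V → Set V) (X0 : Finset V) (q l : ℕ) : Prop :=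
  ∃ (v w : V) (P : G.Walk v w) (X : Finset V) (z : V) (p : G.Walk v z),
    P.IsPath ∧ P.length = l ∧ (∀ x ∈ P.support, x ∈ β X0) ∧ X0 ⊆ X ∧ X.card ≤ X0.card + q ∧
    (∀ x ∈ P.support, x ∉ β X) ∧ z ∈ β X ∧ (∀ x ∈ p.support, x ∈ β X0) ∧
    (∀ x ∈ p.support, x ∈ P.support → x = v)

/-- A good path relative to `X0`. -/
def GoodPath {V : Type} (G : SimpleGraph V) (β : Finset V → Set V) (X0 : Finset V) (q : ℕ) : Prop :=
  ∃ (v w : V) (P : G.Walk v w) (X : Finset V),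
    P.IsPath ∧ (∀ x ∈ P.support, x ∈ β X0) ∧ X0 ⊆ X ∧ X.card ≤ X0.card + q ∧
    (∀ x ∈ P.support, x ∉ β X) ∧
    ∀ S : Finset V, X0 ⊆ S → S.card < X0.card + q → ∃ x ∈ P.support, x ∈ β S

theorem PState.step {V : Type} [DecidableEq V] {G : SimpleGraph V} {k : ℕ}
    {β : Finset V → Set V} (h : IsHaven G k β) {X0 : Finset V} {q l : ℕ} (hk : X0.card + 2 * q ≤ k)
    (hs : PState G β X0 q l) : GoodPath G β X0 q ∨ PState G β X0 q (l + 1) := by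
  obtain ⟨v, w, P, X, z, p, hP, hl, hPβ, hX0, hXc, hPX, hz, hpβ, hpP⟩ := hs
  by_cases hgood : ∀ S : Finset V, X0 ⊆ S → S.card < X0.card + q → ∃ x ∈ P.support, x ∈ β S
  · exact Or.inl ⟨v, w, P, X, hP, hPβ, hX0, hXc, hPX, hgood⟩
  right
  push Not at hgood
  obtain ⟨S, hS0, hSc, hPS⟩ := hgood
  have hcard : (X ∪ S).card ≤ k := by
    have h1 : X ∪ S = X ∪ (S \ X0) := by
      ext a
      simp only [Finset.mem_union, Finset.mem_sdiff]
      constructor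
      · rintro (h | h)
        · exact Or.inl h
        · by_cases h' : a ∈ X0
          · exact Or.inl (hX0 h')
          · exact Or.inr ⟨h, h'⟩
      · tauto
    rw [h1]
    have h2 := Finset.card_union_le X (S \ X0)
    have h3 := Finset.card_sdiff_add_card_eq_card hS0
    omega
  obtain ⟨z', hz'⟩ := (h.1 (X ∪ S) hcard).1.1
  have hXk : X.card ≤ k := (Finset.card_le_card Finset.subset_union_left).trans hcard
  have hSk : S.card ≤ k := (Finset.card_le_card Finset.subset_union_right).trans hcard
  have hz'X : z' ∈ β X := h.2 _ _ Finset.subset_union_left hcard hz'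
  have hz'S : z' ∈ β S := h.2 _ _ Finset.subset_union_right hcard hz'
  have hβX : β X ⊆ β X0 := h.2 _ _ hX0 hXk
  have hβS : β S ⊆ β X0 := h.2 _ _ hS0 hSk
  obtain ⟨r, -, hr⟩ := (h.1 X hXk).1.exists_path hz hz'X
  have hp2path := (p.append r).bypass_isPath
  have hp2sub := (p.append r).support_bypass_subset_support
  set p2 := (p.append r).bypass with hp2
  have hp2β : ∀ x ∈ p2.support, x ∈ β X0 := by
    intro x hx
    have := hp2sub hx
    rw [Walk.mem_support_append_iff] at this
    rcases this with h1 | h1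
    · exact hpβ x h1
    · exact hβX (hr x h1)
  have hp2P : ∀ x ∈ p2.support, x ∈ P.support → x = v := by
    intro x hx hxP
    have := hp2sub hx
    rw [Walk.mem_support_append_iff] at this
    rcases this with h1 | h1
    · exact hpP x h1 hxP
    · exact absurd (hr x h1) (hPX x hxP)
  clear_value p2
  cases p2 with
  | nil => exact absurd hz'S (hPS v (Walk.start_mem_support _))
  | @cons _ u _ huv p' =>
    rw [Walk.cons_isPath_iff] at hp2path
    have huP : u ∉ P.support := by
      intro hu
      have := hp2P u (by simp) hu
      exact hp2path.2 (this ▸ p'.start_mem_support)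
    have huβ : u ∈ β X0 := hp2β u (by simp)
    by_cases huS : u ∈ β S
    · obtain ⟨z2, hz2, hadj⟩ := h.adj_next huS (by omega)
      have hc : (insert u S).card ≤ X0.card + q := by
        have := Finset.card_insert_le u S
        omega
      have hck : (insert u S).card ≤ k := by omega
      have hsub := h.2 S (insert u S) (Finset.subset_insert _ _) hck
      have huN : u ∉ β (insert u S) := fun hh => (h.1 _ hck).2.1 u hh (by simp)
      refine ⟨u, w, Walk.cons huv.symm P, insert u S, z2, Walk.cons hadj Walk.nil, ?_, ?_, ?_, ?_,
        hc, ?_, hz2, ?_, ?_⟩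
      · exact (Walk.cons_isPath_iff _ _).2 ⟨hP, huP⟩
      · simp [hl]
      · intro x hx
        rw [Walk.support_cons, List.mem_cons] at hx
        rcases hx with rfl | hx
        · exact huβ
        · exact hPβ x hx
      · exact hS0.trans (Finset.subset_insert _ _)
      · intro x hx
        rw [Walk.support_cons, List.mem_cons] at hx
        rcases hx with rfl | hx
        · exact huN
        · exact fun hh => hPS x hx (hsub hh)
      · intro x hx
        simp only [Walk.support_cons, Walk.support_nil, List.mem_cons, List.not_mem_nil,
          or_false] at hx
        rcases hx with rfl | rfl
        · exact huβ
        · exact hβS (hsub hz2)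
      · intro x hx hx2
        simp only [Walk.support_cons, Walk.support_nil, List.mem_cons, List.not_mem_nil,
          or_false] at hx hx2
        rcases hx with rfl | rfl
        · rfl
        · rcases hx2 with h1 | h1
          · exact h1
          · exact absurd (hsub hz2) (hPS _ h1)
    · refine ⟨u, w, Walk.cons huv.symm P, S, z', p', ?_, ?_, ?_, hS0,
        hSc.le, ?_, hz'S, ?_, ?_⟩
      · exact (Walk.cons_isPath_iff _ _).2 ⟨hP, huP⟩
      · simp [hl]
      · intro x hx
        rw [Walk.support_cons, List.mem_cons] at hx
        rcases hx with rfl | hx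
        · exact huβ
        · exact hPβ x hx
      · intro x hx
        rw [Walk.support_cons, List.mem_cons] at hx
        rcases hx with rfl | hx
        · exact huS
        · exact hPS x hx
      · intro x hx
        exact hp2β x (by simp [hx])
      · intro x hx hx2
        rw [Walk.support_cons, List.mem_cons] at hx2
        rcases hx2 with h1 | h1
        · exact h1
        · exfalso
          have := hp2P x (by simp [hx]) h1
          exact hp2path.2 (this ▸ hx)

theorem IsHaven.goodPath {V : Type} [Fintype V] {G : SimpleGraph V} {k : ℕ}
    {β : Finset V → Set V} (h : IsHaven G k β) {X0 : Finset V} {q : ℕ} (hq : 1 ≤ q)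
    (hk : X0.card + 2 * q ≤ k) : GoodPath G β X0 q := by
  classical
  by_contra hng
  have hall : ∀ l, PState G β X0 q l := by
    intro l
    induction l with
    | zero =>
      obtain ⟨v, hv⟩ := (h.1 X0 (by omega)).1.1
      obtain ⟨z, hz, hadj⟩ := h.adj_next hv (by omega)
      have hc := Finset.card_insert_le v X0
      have hsub := h.2 X0 (insert v X0) (Finset.subset_insert _ _) (by omega)
      have hvN : v ∉ β (insert v X0) := fun hh => (h.1 _ (by omega)).2.1 v hh (by simp)
      refine ⟨v, v, Walk.nil, insert v X0, z, Walk.cons hadj Walk.nil, Walk.IsPath.nil, rfl, ?_,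
        Finset.subset_insert _ _, by omega, ?_, hz, ?_, ?_⟩
      · intro x hx
        simp at hx
        exact hx ▸ hv
      · intro x hx
        simp at hx
        exact hx ▸ hvN
      · intro x hx
        simp at hx
        rcases hx with rfl | rfl
        · exact hv
        · exact hsub hz
      · intro x _ hx
        simpa using hx
    | succ l ih => exact (ih.step h hk).resolve_left hng
  obtain ⟨v, w, P, X, z, p, hP, hl, -⟩ := hall (Fintype.card V)
  have := hP.length_lt
  omega

theorem IsHaven.two_paths {V : Type} [Fintype V] [DecidableEq V] {G : SimpleGraph V} {q : ℕ}
    {β : Finset V → Set V} (hq : 1 ≤ q) (h : IsHaven G (3 * q) β) :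
    ∃ (v₁ w₁ : V) (P₁ : G.Walk v₁ w₁) (v₂ w₂ : V) (P₂ : G.Walk v₂ w₂), P₁.IsPath ∧ P₂.IsPath ∧
      (∀ x ∈ P₁.support, x ∉ P₂.support) ∧
      Linked G P₁.support.toFinset P₂.support.toFinset q := by
  obtain ⟨v₁, w₁, P₁, X, hP₁, -, -, hXc, hPX, hg₁⟩ := h.goodPath (X0 := ∅) hq (by simp; omega)
  simp only [Finset.card_empty, zero_add] at hXc hg₁
  obtain ⟨v₂, w₂, P₂, X', hP₂, hP₂X, -, -, -, hg₂⟩ := h.goodPath (X0 := X) hq (by omega)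
  refine ⟨v₁, w₁, P₁, v₂, w₂, P₂, hP₁, hP₂, fun x hx hx2 => hPX x hx (hP₂X x hx2), ?_⟩
  apply menger
  intro P Q hA hB hcov hedge
  by_contra hlt
  push Not at hlt
  obtain ⟨a, ha, haS⟩ := hg₁ (P ∩ Q) (by simp) hlt
  have hun := Finset.card_union_le X (P ∩ Q)
  obtain ⟨b, hb, hbS'⟩ := hg₂ (X ∪ (P ∩ Q)) Finset.subset_union_left (by omega)
  have hbS := h.2 (P ∩ Q) (X ∪ (P ∩ Q)) Finset.subset_union_right (by omega) hbS'
  obtain ⟨hconn, hav, -⟩ := h.1 (P ∩ Q) (by omega)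
  have haP : a ∈ P := hA (by simpa using ha)
  have hbQ : b ∈ Q := hB (by simpa using hb)
  have hbP : b ∉ P := fun hh => hav b hbS (by simp [hh, hbQ])
  obtain ⟨u, hu, huP, v, hv, hvP, huv⟩ := hconn.cross {x | x ∈ P} haS haP hbS hbP
  rcases hedge u v huv with h1 | h1
  · exact hvP h1.2
  · exact hav u hu (Finset.mem_inter.2 ⟨huP, h1.1⟩)


/-! ### Minors and the ladder -/

/-- Minor model, phrased with `SConn`. -/
def MinorS {W V : Type} (H : SimpleGraph W) (G : SimpleGraph V) : Prop :=
  ∃ φ : W → Set V, (∀ w, SConn G (φ w)) ∧ (∀ w w' x, x ∈ φ w → x ∈ φ w' → w = w') ∧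
    (∀ w w', H.Adj w w' → ∃ u ∈ φ w, ∃ v ∈ φ w', G.Adj u v)

theorem MinorS.isMinor {W V : Type} {H : SimpleGraph W} {G : SimpleGraph V} (h : MinorS H G) :
    IsMinor H G := by
  obtain ⟨φ, h1, h2, h3⟩ := h
  refine ⟨φ, fun w => ⟨(h1 w).1, (sconn_iff _ _).1 (h1 w)⟩, ?_, h3⟩
  intro w w' hw
  rw [Set.disjoint_left]
  exact fun x hx hx' => hw (h2 w w' x hx hx')

theorem SConn.blowup {V V' : Type} {G : SimpleGraph V} {K : SimpleGraph V'} (φ : V → Set V')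
    (h1 : ∀ w, SConn K (φ w)) (h3 : ∀ w w', G.Adj w w' → ∃ u ∈ φ w, ∃ v ∈ φ w', K.Adj u v)
    {S : Set V} (hS : SConn G S) : SConn K {x | ∃ v ∈ S, x ∈ φ v} := by
  refine ⟨?_, ?_⟩
  · obtain ⟨s, hs⟩ := hS.1
    obtain ⟨x, hx⟩ := (h1 s).1
    exact ⟨x, s, hs, hx⟩
  · rintro Y ⟨x, ⟨s, hs, hx⟩, hxY⟩ hcl
    have key : ∀ v ∈ S, ∀ z ∈ φ v, z ∈ Y → φ v ⊆ Y := fun v hv z hz hzY =>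
      (h1 v).2 Y ⟨z, hz, hzY⟩ (fun a ha haY b hb hab => hcl a ⟨v, hv, ha⟩ haY b ⟨v, hv, hb⟩ hab)
    have := hS.2 {v | φ v ⊆ Y} ⟨s, hs, key s hs x hx hxY⟩ (by
      intro u hu huY v hv huv
      obtain ⟨a, ha, b, hb, hab⟩ := h3 u v huv
      exact key v hv b hb (hcl a ⟨u, hu, ha⟩ (huY ha) b ⟨v, hv, hb⟩ hab))
    rintro y ⟨v, hv, hy⟩
    exact this hv hy

theorem MinorS.trans {W V V' : Type} {H : SimpleGraph W} {G : SimpleGraph V} {K : SimpleGraph V'}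
    (h : MinorS H G) (h' : MinorS G K) : MinorS H K := by
  obtain ⟨ψ, g1, g2, g3⟩ := h
  obtain ⟨φ, h1, h2, h3⟩ := h'
  refine ⟨fun w => {x | ∃ v ∈ ψ w, x ∈ φ v}, fun w => (g1 w).blowup φ h1 h3, ?_, ?_⟩
  · rintro w w' x ⟨v, hv, hx⟩ ⟨v', hv', hx'⟩
    have := h2 v v' x hx hx'
    subst this
    exact g2 w w' v hv hv'
  · intro w w' hw
    obtain ⟨u, hu, v, hv, huv⟩ := g3 w w' hw
    obtain ⟨a, ha, b, hb, hab⟩ := h3 u v huv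
    exact ⟨a, ⟨u, hu, ha⟩, b, ⟨v, hv, hb⟩, hab⟩

/-- Two paths of length `q` joined by a perfect matching (the chords). -/
def Ladder (q : ℕ) (pos : Bool → Equiv.Perm (Fin q)) : SimpleGraph (Bool × Fin q) where
  Adj u v := (u.1 = v.1 ∧ (u.2.val + 1 = v.2.val ∨ v.2.val + 1 = u.2.val)) ∨
    (u.1 ≠ v.1 ∧ (pos u.1).symm u.2 = (pos v.1).symm v.2)
  symm := ⟨fun u v h => by
    rcases h with ⟨h1, h2⟩ | ⟨h1, h2⟩
    · exact Or.inl ⟨h1.symm, h2.symm⟩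
    · exact Or.inr ⟨h1.symm, h2.symm⟩⟩
  loopless := ⟨fun u h => by
    rcases h with ⟨h1, h2⟩ | ⟨h1, h2⟩
    · omega
    · exact h1 rfl⟩

theorem path_segments {V : Type} {G : SimpleGraph V} {v w : V} (P : G.Walk v w) (hP : P.IsPath)
    {q : ℕ} (g : Fin q → ℕ) (hg : StrictMono g) (hgL : ∀ x, g x ≤ P.length) :
    ∃ T : Fin q → Set V, (∀ x, SConn G (T x)) ∧ (∀ x, P.getVert (g x) ∈ T x) ∧
      (∀ x y z, z ∈ T x → z ∈ T y → x = y) ∧ (∀ x, ∀ z ∈ T x, z ∈ P.support) ∧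
      (∀ x y : Fin q, x.val + 1 = y.val → ∃ u ∈ T x, ∃ v ∈ T y, G.Adj u v) := by
  let h : ℕ → ℕ := fun x => if hx : x < q then g ⟨x, hx⟩ else P.length + 1
  have hgx : ∀ x : Fin q, h x = g x := fun x => by simp [h]
  have hmono : ∀ x y, x < y → y ≤ q → h x < h y := by
    intro x y hxy hy
    have hx : x < q := by omega
    by_cases hy' : y < q
    · simp only [h, hx, hy', dif_pos]
      exact hg (by simpa using hxy)
    · simp only [h, hx, hy', dif_pos, dif_neg, not_false_iff]
      have := hgL ⟨x, hx⟩
      omega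
  have hmono' : ∀ x y, x ≤ y → y ≤ q → h x ≤ h y := by
    intro x y hxy hy
    rcases hxy.eq_or_lt with rfl | h'
    · exact le_rfl
    · exact (hmono x y h' hy).le
  have hq : h q = P.length + 1 := by simp [h]
  have hle : ∀ x : Fin q, h (x + 1) ≤ P.length + 1 := fun x => hq ▸ hmono' _ _ (by omega) le_rfl
  have hlt : ∀ x : Fin q, h x < h (x + 1) := fun x => hmono _ _ (by omega) (by omega)
  refine ⟨fun x => {z | ∃ i, h x ≤ i ∧ i ≤ h (x + 1) - 1 ∧ P.getVert i = z}, ?_, ?_, ?_, ?_, ?_⟩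
  · intro x
    have := hlt x
    have := hle x
    refine SConn.chain _ _ _ (by omega) ?_
    intro i hi hi'
    exact P.adj_getVert_succ (by omega)
  · intro x
    exact ⟨g x, (hgx x).le, by have := hlt x; rw [hgx] at this; omega, rfl⟩
  · rintro x y z ⟨i, hi, hi', hz⟩ ⟨j, hj, hj', hz'⟩
    have hij : i = j := by
      have := hle x
      have := hlt x
      have := hle y
      have := hlt y
      apply hP.getVert_injOn (by simp; omega) (by simp; omega)
      rw [hz, hz']
    subst hij
    rcases lt_trichotomy x.val y.val with h1 | h1 | h1
    · have := hmono' (x + 1) y (by omega) (by omega)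
      have := hlt x
      omega
    · exact Fin.ext h1
    · have := hmono' (y + 1) x (by omega) (by omega)
      have := hlt y
      omega
  · rintro x z ⟨i, hi, hi', rfl⟩
    exact P.getVert_mem_support i
  · intro x y hxy
    have h1 := hlt x
    have h2 := hle x
    have h3 := hlt y
    have h4 := hle y
    rw [← hxy] at h3 h4
    refine ⟨P.getVert (h (x + 1) - 1), ⟨_, by omega, le_rfl, rfl⟩, P.getVert (h (x + 1)),
      ⟨_, by rw [hxy], by rw [← hxy]; omega, rfl⟩, ?_⟩
    have := P.adj_getVert_succ (i := h (x + 1) - 1) (by omega)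
    rwa [Nat.sub_add_cancel (by omega)] at this

theorem ladder_minor {V : Type} [DecidableEq V] {G : SimpleGraph V} {q : ℕ}
    {v₁ w₁ : V} {P₁ : G.Walk v₁ w₁} {v₂ w₂ : V} {P₂ : G.Walk v₂ w₂} (hP₁ : P₁.IsPath)
    (hP₂ : P₂.IsPath) (hdisj : ∀ x ∈ P₁.support, x ∉ P₂.support)
    (hL : Linked G P₁.support.toFinset P₂.support.toFinset q) :
    ∃ pos : Bool → Equiv.Perm (Fin q), MinorS (Ladder q pos) G := by
  obtain ⟨D, a, b, hD, hDd, ha, hb⟩ := hL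
  simp only [List.mem_toFinset] at ha hb
  have hα : ∀ i, ∃ n, P₁.getVert n = a i ∧ n ≤ P₁.length := fun i =>
    (Walk.mem_support_iff_exists_getVert.1 (ha i).2.1)
  have hγ : ∀ i, ∃ n, P₂.getVert n = b i ∧ n ≤ P₂.length := fun i =>
    (Walk.mem_support_iff_exists_getVert.1 (hb i).2.1)
  choose α hα hαL using hα
  choose γ hγ hγL using hγ
  have hαinj : Function.Injective α := fun i j hij =>
    hDd i j (a i) (ha i).1 (by rw [← hα i, hij, hα j]; exact (ha j).1)
  have hγinj : Function.Injective γ := fun i j hij =>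
    hDd i j (b i) (hb i).1 (by rw [← hγ i, hij, hγ j]; exact (hb j).1)
  have hs₁ : StrictMono (α ∘ Tuple.sort α) := (Tuple.monotone_sort α).strictMono_of_injective
    (hαinj.comp (Tuple.sort α).injective)
  have hs₂ : StrictMono (γ ∘ Tuple.sort γ) := (Tuple.monotone_sort γ).strictMono_of_injective
    (hγinj.comp (Tuple.sort γ).injective)
  obtain ⟨T₁, c1, g1, d1, s1, e1⟩ := path_segments P₁ hP₁ _ hs₁ (fun x => hαL _)
  obtain ⟨T₂, c2, g2, d2, s2, e2⟩ := path_segments P₂ hP₂ _ hs₂ (fun x => hγL _)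
  have hC : ∀ i, ∃ C : Set V, SConn G C ∧ a i ∈ C ∧ C ⊆ D i ∧ b i ∉ C ∧ ∃ u ∈ C, G.Adj u (b i) := by
    intro i
    obtain ⟨p, hp, hpD⟩ := (hD i).exists_path (hb i).1 (ha i).1
    have hne : b i ≠ a i := fun h => hdisj _ (ha i).2.1 (h ▸ (hb i).2.1)
    obtain ⟨u, huv, p', hp'⟩ := Walk.exists_eq_cons_of_ne hne p
    · rw [hp'] at hp hpD
      rw [Walk.cons_isPath_iff] at hp
      exact ⟨{x | x ∈ p'.support}, SConn.of_walk p', p'.end_mem_support,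
        fun x hx => hpD x (by rw [Walk.support_cons]; exact List.mem_cons_of_mem _ hx), hp.2,
        u, p'.start_mem_support, huv.symm⟩
  choose C hC haC hCD hbC hCb using hC
  simp only [Function.comp] at g1 g2
  refine ⟨fun c => cond c (Tuple.sort γ).symm (Tuple.sort α).symm,
    fun w => cond w.1 (T₂ w.2) (T₁ w.2 ∪ C (Tuple.sort α w.2)), ?_, ?_, ?_⟩
  · rintro ⟨_ | _, x⟩
    · refine (c1 x).union (hC _) (Or.inl ⟨_, g1 x, ?_⟩)
      rw [hα]; exact haC _
    · exact c2 x
  · have hTC : ∀ x y z, z ∈ T₁ x → z ∈ C (Tuple.sort α y) → x = y := by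
      intro x y z hz hz'
      have := (ha _).2.2 z (hCD _ hz') (s1 x z hz)
      rw [← hα] at this
      exact d1 x y z hz (this ▸ g1 y)
    have hCT : ∀ x y z, z ∈ T₂ x → z ∈ C y → False := by
      intro x y z hz hz'
      have := (hb _).2.2 z (hCD _ hz') (s2 x z hz)
      exact hbC y (this ▸ hz')
    rintro ⟨_ | _, x⟩ ⟨_ | _, y⟩ z hz hz'
    · have : x = y := by
        rcases hz with hz | hz <;> rcases hz' with hz' | hz'
        · exact d1 x y z hz hz'
        · exact hTC x y z hz hz'
        · exact (hTC y x z hz' hz).symm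
        · exact (Tuple.sort α).injective (hDd _ _ z (hCD _ hz) (hCD _ hz'))
      rw [this]
    · exfalso
      rcases hz with hz | hz
      · exact hdisj z (s1 _ z hz) (s2 _ z hz')
      · exact hCT _ _ z hz' hz
    · exfalso
      rcases hz' with hz' | hz'
      · exact hdisj z (s1 _ z hz') (s2 _ z hz)
      · exact hCT _ _ z hz hz'
    · rw [d2 x y z hz hz']
  · have h1 : ∀ x y : Fin q, x.val + 1 = y.val →
        ∃ u ∈ T₁ x ∪ C (Tuple.sort α x), ∃ v ∈ T₁ y ∪ C (Tuple.sort α y), G.Adj u v := by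
      intro x y hxy
      obtain ⟨u, hu, v, hv, huv⟩ := e1 x y hxy
      exact ⟨u, Or.inl hu, v, Or.inl hv, huv⟩
    have h2 : ∀ x y : Fin q, Tuple.sort α x = Tuple.sort γ y →
        ∃ u ∈ T₁ x ∪ C (Tuple.sort α x), ∃ v ∈ T₂ y, G.Adj u v := by
      intro x y hxy
      obtain ⟨u, hu, huv⟩ := hCb (Tuple.sort α x)
      refine ⟨u, Or.inr hu, _, g2 y, ?_⟩
      rw [hγ, ← hxy]
      exact huv
    have flip : ∀ A B : Set V, (∃ u ∈ A, ∃ v ∈ B, G.Adj u v) → ∃ u ∈ B, ∃ v ∈ A, G.Adj u v := by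
      rintro A B ⟨u, hu, v, hv, huv⟩
      exact ⟨v, hv, u, hu, huv.symm⟩
    rintro ⟨_ | _, x⟩ ⟨_ | _, y⟩ (⟨hw, hw'⟩ | ⟨hw, hw'⟩)
    · rcases hw' with hw' | hw'
      · exact h1 x y hw'
      · exact flip _ _ (h1 y x hw')
    · exact absurd rfl hw
    · simp at hw
    · exact h2 x y hw'
    · simp at hw
    · exact flip _ _ (h2 y x hw'.symm)
    · rcases hw' with hw' | hw'
      · exact e2 x y hw'
      · exact flip _ _ (e2 y x hw')
    · exact absurd rfl hw



/-! ### Short handles in bipartite multigraphs of minimum degree three -/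

theorem exists_mindeg_three {J : Type} [DecidableEq J] {N : ℕ} (f : Bool → J → Fin N) :
    ∀ (n : ℕ) (M : Finset J), M.card = n →
      2 * ((Finset.univ ×ˢ M).image (fun z : Bool × J => (z.1, f z.1 z.2))).card < M.card →
      ∃ M' ⊆ M, M'.Nonempty ∧
        ∀ b, ∀ j ∈ M', 3 ≤ (M'.filter (fun j' => f b j' = f b j)).card := by
  intro n
  induction n using Nat.strong_induction_on with
  | _ n ih =>
  intro M hMn hM
  by_cases hdeg : ∀ b, ∀ j ∈ M, 3 ≤ (M.filter (fun j' => f b j' = f b j)).card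
  · exact ⟨M, subset_rfl, Finset.card_pos.1 (by omega), hdeg⟩
  push Not at hdeg
  obtain ⟨b, j, hj, hlt⟩ := hdeg
  set M' := M.filter (fun j' => ¬ f b j' = f b j) with hM'
  have hsum : (M.filter (fun j' => f b j' = f b j)).card + M'.card = M.card := by
    rw [hM', ← Finset.card_filter_add_card_filter_not (s := M) (fun j' => f b j' = f b j)]
  have hpos : 0 < (M.filter (fun j' => f b j' = f b j)).card :=
    Finset.card_pos.2 ⟨j, by simp [hj]⟩
  have hsub : M' ⊆ M := Finset.filter_subset _ _
  have hT : ((Finset.univ ×ˢ M').image (fun z : Bool × J => (z.1, f z.1 z.2))).card <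
      ((Finset.univ ×ˢ M).image (fun z : Bool × J => (z.1, f z.1 z.2))).card := by
    apply Finset.card_lt_card
    rw [Finset.ssubset_iff_of_subset
      (Finset.image_subset_image (Finset.product_subset_product_right hsub))]
    refine ⟨(b, f b j), Finset.mem_image.2 ⟨(b, j), by simp [hj], rfl⟩, ?_⟩
    intro h
    obtain ⟨⟨b', j'⟩, h1, h2⟩ := Finset.mem_image.1 h
    simp only [Prod.mk.injEq] at h2
    obtain ⟨rfl, h2⟩ := h2
    simp only [hM', Finset.mem_product, Finset.mem_univ, true_and, Finset.mem_filter] at h1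
    exact h1.2 h2
  obtain ⟨M'', h1, h2, h3⟩ := ih M'.card (by omega) M' rfl (by omega)
  exact ⟨M'', h1.trans hsub, h2, h3⟩

/-- The block graph. -/
def BlockGraph {J : Type} {N : ℕ} (f : Bool → J → Fin N) (M : Finset J) :
    SimpleGraph (Bool × Fin N) where
  Adj u v := u.1 ≠ v.1 ∧ ∃ j ∈ M, f u.1 j = u.2 ∧ f v.1 j = v.2
  symm := ⟨fun u v ⟨h1, j, hj, h2, h3⟩ => ⟨h1.symm, j, hj, h3, h2⟩⟩
  loopless := ⟨fun u h => h.1 rfl⟩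

theorem BlockGraph.touched {J : Type} {N : ℕ} {f : Bool → J → Fin N} {M : Finset J}
    {r v : Bool × Fin N} (p : (BlockGraph f M).Walk r v) (hr : ∃ j ∈ M, f r.1 j = r.2) :
    ∀ x ∈ p.support, ∃ j ∈ M, f x.1 j = x.2 := by
  induction p with
  | nil => intro x hx; simp at hx; exact hx ▸ hr
  | cons h p ih =>
    intro x hx
    rw [Walk.support_cons, List.mem_cons] at hx
    rcases hx with rfl | hx
    · exact hr
    · obtain ⟨_, j, hj, _, h3⟩ := h
      exact ih ⟨j, hj, h3⟩ x hx

theorem exists_handle {J : Type} [DecidableEq J] {N R : ℕ} (f : Bool → J → Fin N) (M : Finset J)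
    (hM : M.Nonempty) (hdeg : ∀ b, ∀ j ∈ M, 3 ≤ (M.filter (fun j' => f b j' = f b j)).card)
    (hN : 2 * N < 2 ^ R) :
    ∃ (b : Bool) (j j' : J) (K : Finset (Bool × Fin N)), j ∈ M ∧ j' ∈ M ∧ j ≠ j' ∧
      f b j = f b j' ∧ (b, f b j) ∉ K ∧ (!b, f (!b) j) ∈ K ∧ (!b, f (!b) j') ∈ K ∧
      SConn (BlockGraph f M) {x | x ∈ K} ∧ (∀ x ∈ K, ∃ i ∈ M, f x.1 i = x.2) ∧
      K.card ≤ 2 * R + 2 := by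
  by_contra hcon
  obtain ⟨j₀, hj₀⟩ := hM
  set Γ := BlockGraph f M with hΓ
  set r : Bool × Fin N := (false, f false j₀) with hr
  have hrt : ∃ j ∈ M, f r.1 j = r.2 := ⟨j₀, hj₀, rfl⟩
  -- geodesics
  have hgeo : ∀ x, Γ.Reachable r x → ∃ p : Γ.Walk r x, p.length = Γ.dist r x ∧
      ∀ u ∈ p.support, u = x ∨ Γ.dist r u < Γ.dist r x := by
    intro x hx
    obtain ⟨p, hp⟩ := hx.exists_walk_length_eq_dist
    refine ⟨p, hp, ?_⟩
    intro u hu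
    by_cases h : u = x
    · exact Or.inl h
    right
    have h1 := congrArg Walk.length (p.take_spec hu)
    rw [Walk.length_append] at h1
    have h2 : 0 < (p.dropUntil u hu).length := by
      rw [Nat.pos_iff_ne_zero]
      intro h0
      exact h (Walk.eq_of_length_eq_zero h0)
    have h3 := dist_le (p.takeUntil u hu)
    omega
  have hadj : ∀ (w : Bool × Fin N) (j : J), j ∈ M → f w.1 j = w.2 → Γ.Adj w (!w.1, f (!w.1) j) := by
    intro w j hj hw
    refine ⟨by simp, j, hj, hw, rfl⟩
  have claim1 : ∀ (w : Bool × Fin N) (i : ℕ), i ≤ R → Γ.Reachable r w → Γ.dist r w = i →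
      (M.filter (fun j => f w.1 j = w.2 ∧ Γ.dist r (!w.1, f (!w.1) j) ≤ i)).card ≤ 1 := by
    intro w i hi hw hwd
    rw [Finset.card_le_one]
    intro j hj j' hj'
    rw [Finset.mem_filter] at hj hj'
    by_contra hne
    apply hcon
    have r1 : Γ.Reachable r (!w.1, f (!w.1) j) := hw.trans (hadj w j hj.1 hj.2.1).reachable
    have r2 : Γ.Reachable r (!w.1, f (!w.1) j') := hw.trans (hadj w j' hj'.1 hj'.2.1).reachable
    obtain ⟨p, hp, hpw⟩ := hgeo _ r1
    obtain ⟨p', hp', hpw'⟩ := hgeo _ r2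
    refine ⟨w.1, j, j', p.support.toFinset ∪ p'.support.toFinset, hj.1, hj'.1, hne,
      hj.2.1.trans hj'.2.1.symm, ?_, ?_, ?_, ?_, ?_, ?_⟩
    · rw [hj.2.1]
      intro h
      simp only [Finset.mem_union, List.mem_toFinset] at h
      rcases h with h | h
      · rcases hpw _ h with h | h
        · have := congrArg Prod.fst h
          simp at this
        · change Γ.dist r w < _ at h
          omega
      · rcases hpw' _ h with h | h
        · have := congrArg Prod.fst h
          simp at this
        · change Γ.dist r w < _ at h
          omega
    · simp
    · simp
    · have := (SConn.of_walk p).union (SConn.of_walk p') (Or.inl ⟨r, by simp, by simp⟩)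
      convert this using 1
      ext x
      simp
    · intro x hx
      simp only [Finset.mem_union, List.mem_toFinset] at hx
      rcases hx with hx | hx
      · exact BlockGraph.touched p hrt x hx
      · exact BlockGraph.touched p' hrt x hx
    · have h1 := Finset.card_union_le p.support.toFinset p'.support.toFinset
      have h2 := p.support.toFinset_card_le
      have h3 := p'.support.toFinset_card_le
      rw [Walk.length_support] at h2 h3
      omega
  classical
  let S : ℕ → Finset (Bool × Fin N) := fun i =>
    Finset.univ.filter (fun v => (∃ j ∈ M, f v.1 j = v.2) ∧ Γ.Reachable r v ∧ Γ.dist r v = i)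
  have hS : ∀ i v, v ∈ S i ↔ (∃ j ∈ M, f v.1 j = v.2) ∧ Γ.Reachable r v ∧ Γ.dist r v = i := by
    intro i v
    simp [S]
  have hgrow : ∀ i, i + 1 ≤ R → 2 * (S i).card ≤ (S (i + 1)).card := by
    intro i hi
    let D : Finset (Bool × J) := (Finset.univ ×ˢ M).filter
      (fun z => (z.1, f z.1 z.2) ∈ S i ∧ (!z.1, f (!z.1) z.2) ∈ S (i + 1))
    have hD : ∀ z, z ∈ D ↔ z.2 ∈ M ∧ (z.1, f z.1 z.2) ∈ S i ∧ (!z.1, f (!z.1) z.2) ∈ S (i + 1) := by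
      intro z
      simp [D]
    have e1 := Finset.card_eq_sum_card_fiberwise (s := D) (t := S i)
      (f := fun z => (z.1, f z.1 z.2)) (fun z hz => ((hD z).1 hz).2.1)
    have e2 := Finset.card_eq_sum_card_fiberwise (s := D) (t := S (i + 1))
      (f := fun z => (!z.1, f (!z.1) z.2)) (fun z hz => ((hD z).1 hz).2.2)
    have b1 : 2 * (S i).card ≤ D.card := by
      rw [e1, mul_comm, ← smul_eq_mul]
      apply Finset.card_nsmul_le_sum
      intro w hw
      have hw' := (hS i w).1 hw
      obtain ⟨⟨j, hj, hjw⟩, hwr, hwd⟩ := hw'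
      have h1 := claim1 w i (by omega) hwr hwd
      have h2 := hdeg w.1 j hj
      rw [hjw] at h2
      have h3 := Finset.card_filter_add_card_filter_not (s := M.filter (fun j' => f w.1 j' = w.2))
        (fun j => Γ.dist r (!w.1, f (!w.1) j) ≤ i)
      rw [Finset.filter_filter, Finset.filter_filter] at h3
      have h4 : 2 ≤ (M.filter (fun j' => f w.1 j' = w.2 ∧ ¬ Γ.dist r (!w.1, f (!w.1) j') ≤ i)).card := by
        omega
      refine h4.trans ?_
      refine Finset.card_le_card_of_injOn (fun j => (w.1, j)) ?_ ?_
      · intro j' hj'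
        rw [Finset.mem_coe, Finset.mem_filter] at hj'
        rw [Finset.mem_coe, Finset.mem_filter, hD]
        have hadj' := hadj w j' hj'.1 hj'.2.1
        have hww : ((w.1, f w.1 j') : Bool × Fin N) = w := by rw [hj'.2.1]
        refine ⟨⟨hj'.1, by simpa only [hww] using hw, ?_⟩, hww⟩
        rw [hS]
        refine ⟨⟨j', hj'.1, rfl⟩, hwr.trans hadj'.reachable, ?_⟩
        obtain ⟨p, hp⟩ := hwr.exists_walk_length_eq_dist
        have := dist_le (p.append (Walk.cons hadj' Walk.nil))
        rw [Walk.length_append, Walk.length_cons, Walk.length_nil] at this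
        have := hj'.2.2
        simp only at *
        omega
      · intro a _ b _ hab
        simpa using hab
    have b2 : D.card ≤ (S (i + 1)).card := by
      rw [e2, Finset.card_eq_sum_ones]
      apply Finset.sum_le_sum
      intro w hw
      obtain ⟨-, hwr, hwd⟩ := (hS _ w).1 hw
      refine le_trans ?_ (claim1 w (i + 1) hi hwr hwd)
      refine Finset.card_le_card_of_injOn (fun z => z.2) ?_ ?_
      · rintro ⟨b, j⟩ hz
        rw [Finset.mem_coe, Finset.mem_filter, hD] at hz
        obtain ⟨⟨h1, h2, h3⟩, h4⟩ := hz
        simp only at h1 h2 h3 h4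
        subst h4
        rw [Finset.mem_coe, Finset.mem_filter]
        refine ⟨h1, rfl, ?_⟩
        have := ((hS _ _).1 h2).2.2
        simp only [Bool.not_not]
        omega
      · rintro ⟨b, j⟩ hz ⟨b', j'⟩ hz' hzz
        rw [Finset.mem_coe, Finset.mem_filter] at hz hz'
        have h1 := hz.2
        have h2 := hz'.2
        simp only at h1 h2 hzz
        rw [← h2] at h1
        have := congrArg Prod.fst h1
        simp only [Bool.not_eq_eq_eq_not, Bool.not_not] at this
        rw [this, hzz]
    omega
  have hpow : ∀ i, i ≤ R → 2 ^ i ≤ (S i).card := by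
    intro i
    induction i with
    | zero =>
      intro _
      rw [pow_zero]
      exact Finset.card_pos.2 ⟨r, (hS _ _).2 ⟨hrt, Reachable.refl _, dist_self⟩⟩
    | succ i ih =>
      intro hi
      have h1 := ih (by omega)
      have h2 := hgrow i hi
      rw [pow_succ]
      omega
  have h1 := hpow R le_rfl
  have h2 := Finset.card_le_univ (S R)
  simp only [Fintype.card_prod, Fintype.card_bool, Fintype.card_fin] at h2
  omega


/-! ### Cycle certificates in the ladder -/

/-- `B` contains a path with `lam` vertices, closed up by a disjoint connected set. -/
def Cert {V : Type} (G : SimpleGraph V) (lam : ℕ) (B : Set V) : Prop :=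
  ∃ (p : ℕ → V) (K : Set V), (∀ i < lam, p i ∈ B) ∧ (∀ i < lam, ∀ j < lam, p i = p j → i = j) ∧
    (∀ i, i + 1 < lam → G.Adj (p i) (p (i + 1))) ∧ K ⊆ B ∧ SConn G K ∧ (∀ i < lam, p i ∉ K) ∧
    (∃ u ∈ K, G.Adj u (p 0)) ∧ (∃ u ∈ K, G.Adj (p (lam - 1)) u)

theorem Ladder.step {q : ℕ} (pos : Bool → Equiv.Perm (Fin q)) (b : Bool) (x y : Fin q)
    (h : x.val + 1 = y.val) : (Ladder q pos).Adj (b, x) (b, y) := Or.inl ⟨rfl, Or.inl h⟩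

theorem Ladder.chord {q : ℕ} (pos : Bool → Equiv.Perm (Fin q)) (b c : Bool) (hbc : b ≠ c)
    (j : Fin q) : (Ladder q pos).Adj (b, pos b j) (c, pos c j) := by
  refine Or.inr ⟨hbc, ?_⟩
  simp

/-- The `i`-th vertex on side `b`. -/
def lv (q : ℕ) (hq : 0 < q) (b : Bool) (i : ℕ) : Bool × Fin q := (b, ⟨i % q, Nat.mod_lt _ hq⟩)

theorem lv_val {q : ℕ} (hq : 0 < q) (b : Bool) {i : ℕ} (hi : i < q) : (lv q hq b i).2.val = i :=
  Nat.mod_eq_of_lt hi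

theorem lv_adj {q : ℕ} (hq : 0 < q) (pos : Bool → Equiv.Perm (Fin q)) (b : Bool) {i : ℕ}
    (hi : i + 1 < q) : (Ladder q pos).Adj (lv q hq b i) (lv q hq b (i + 1)) := by
  apply Ladder.step
  change i % q + 1 = (i + 1) % q
  rw [Nat.mod_eq_of_lt hi, Nat.mod_eq_of_lt (by omega)]

theorem Ladder.interval {q : ℕ} (pos : Bool → Equiv.Perm (Fin q)) (b : Bool) (a c : ℕ)
    (hac : a ≤ c) (hc : c < q) :
    SConn (Ladder q pos) {z | z.1 = b ∧ a ≤ z.2.val ∧ z.2.val ≤ c} := by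
  have hq : 0 < q := by omega
  have := SConn.chain (G := Ladder q pos) (lv q hq b) a c hac
    (fun i _ hi => lv_adj hq pos b (by omega))
  convert this using 1
  ext ⟨b', x⟩
  simp only [Set.mem_setOf_eq]
  constructor
  · rintro ⟨rfl, h1, h2⟩
    exact ⟨x.val, h1, h2, Prod.ext rfl (Fin.ext (Nat.mod_eq_of_lt x.2))⟩
  · rintro ⟨i, h1, h2, h3⟩
    have h4 := congrArg Prod.fst h3
    have h5 := congrArg (fun z => z.2.val) h3
    simp only at h4 h5
    rw [lv_val hq b (by omega)] at h5
    refine ⟨h4.symm, by omega, by omega⟩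

theorem cert_of_handle {q N lam : ℕ} (hlam : 0 < lam) (hqN : q = 16 * (16 * lam) * N)
    (pos : Bool → Equiv.Perm (Fin q)) (dv : Fin q → Fin N)
    (hdv : ∀ x, (dv x).val = x.val / (16 * (16 * lam))) (M : Finset (Fin q)) (b : Bool)
    (j j' : Fin q) (K : Finset (Bool × Fin N))
    (hoff : (pos b j).val % (16 * lam) < 15 * lam)
    (hlt : (pos b j).val / (16 * lam) < (pos b j').val / (16 * lam))
    (hf : dv (pos b j) = dv (pos b j')) (hbK : (b, dv (pos b j)) ∉ K)
    (hj : (!b, dv (pos (!b) j)) ∈ K) (hj' : (!b, dv (pos (!b) j')) ∈ K)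
    (hK : SConn (BlockGraph (fun b j => dv (pos b j)) M) {x | x ∈ K}) :
    Cert (Ladder q pos) lam {z | (z.1, dv z.2) ∈ insert (b, dv (pos b j)) K} := by
  set L := 16 * (16 * lam) with hL
  set P := (pos b j).val with hP
  set P' := (pos b j').val with hP'
  set X := (dv (pos b j)).val with hX
  have hXP : X = P / L := hdv _
  have hXP' : X = P' / L := by rw [hX, hf]; exact hdv _
  set J := 16 * lam with hJ
  have hJ0 : 0 < J := by omega
  have hL0 : 0 < L := by omega
  have e1 := Nat.div_add_mod P J
  have e2 := Nat.div_add_mod P' J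
  have e3 := Nat.div_add_mod P L
  have e4 := Nat.div_add_mod P' L
  have m4 := Nat.mod_lt P' hL0
  rw [← hXP] at e3
  rw [← hXP'] at e4
  have hX1 : X = P' / J / 16 := by rw [hXP', Nat.div_div_eq_div_mul, hL, mul_comm 16 J]
  have hX2 : X = P / J / 16 := by rw [hXP, Nat.div_div_eq_div_mul, hL, mul_comm 16 J]
  have e5 : J * (P / J + 1) ≤ J * (P' / J) := Nat.mul_le_mul_left _ hlt
  have e6 : J * (P' / J + 1) ≤ J * (16 * X + 16) := Nat.mul_le_mul_left _ (by omega)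
  have e7 : L * X = J * (16 * X) := by rw [hL]; ring
  have e8 : L * (X + 1) ≤ L * N := Nat.mul_le_mul_left _ (dv (pos b j)).2
  have e9 : J * (16 * X) ≤ J * (P / J) := Nat.mul_le_mul_left _ (by omega)
  rw [← hqN] at e8
  rw [Nat.mul_add, Nat.mul_one] at e5 e6 e8
  rw [Nat.mul_add] at e6
  set T := J * (P' / J) with hT
  set S := J * (P / J) with hS
  rw [← e7] at e6 e9
  have hLJ : L = J * 16 := by omega
  rw [← hLJ] at e6
  set Y := L * X with hY
  have hq : 0 < q := by omega
  have hPq : P < q := (pos b j).2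
  have hPq' : P' < q := (pos b j').2
  have hPT : P + 1 ≤ T - lam := by omega
  have hin : ∀ x : Fin q, Y ≤ x.val → x.val < Y + L → dv x = dv (pos b j) := by
    intro x h1 h2
    apply Fin.ext
    rw [hdv, ← hX]
    apply Nat.div_eq_of_lt_le
    · rw [mul_comm]; exact h1
    · rw [mul_comm, Nat.mul_add, Nat.mul_one]; exact h2
  have hmid : SConn (Ladder q pos) {z | (z.1, dv z.2) ∈ K} := by
    have := SConn.blowup (K := Ladder q pos) (fun v : Bool × Fin N => {z | (z.1, dv z.2) = v})
      ?_ ?_ hK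
    · convert this using 1
      ext z
      simp
    · rintro ⟨c, y⟩
      have h8 : L * (y.val + 1) ≤ L * N := Nat.mul_le_mul_left _ y.2
      rw [← hqN, Nat.mul_add, Nat.mul_one] at h8
      have := Ladder.interval pos c (L * y.val) (L * y.val + L - 1) (by omega) (by omega)
      convert this using 1
      ext ⟨c', x⟩
      simp only [Set.mem_setOf_eq, Prod.mk.injEq]
      apply and_congr Iff.rfl
      rw [Fin.ext_iff, hdv]
      have h3 := Nat.div_add_mod x.val L
      have h4 := Nat.mod_lt x.val hL0
      constructor
      · intro h
        rw [h] at h3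
        omega
      · rintro ⟨h1, h2⟩
        apply Nat.div_eq_of_lt_le
        · rw [mul_comm]; exact h1
        · rw [mul_comm, Nat.mul_add, Nat.mul_one]; omega
    · rintro u v ⟨h1, i, hi, h2, h3⟩
      refine ⟨(u.1, pos u.1 i), ?_, (v.1, pos v.1 i), ?_, Ladder.chord pos _ _ h1 i⟩
      · exact Prod.ext rfl h2
      · exact Prod.ext rfl h3
  have hleft := Ladder.interval pos b Y (T - lam - 1) (by omega) (by omega)
  have hright := Ladder.interval pos b T (Y + L - 1) (by omega) (by omega)
  have hconn := (hleft.union hmid (Or.inr ⟨(b, pos b j), ⟨rfl, by rw [← hP]; omega⟩,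
    (!b, pos (!b) j), hj, Ladder.chord pos _ _ (by simp) j⟩)).union hright
      (Or.inr ⟨(!b, pos (!b) j'), Or.inr hj', (b, pos b j'), ⟨rfl, by rw [← hP']; omega⟩,
        Ladder.chord pos _ _ (by simp) j'⟩)
  refine ⟨fun i => lv q hq b (T - lam + i), _, ?_, ?_, ?_, ?_, hconn, ?_, ?_, ?_⟩
  · intro i hi
    have := lv_val hq b (i := T - lam + i) (by omega)
    apply Finset.mem_insert.2
    left
    exact Prod.ext rfl (hin (lv q hq b (T - lam + i)).2 (by omega) (by omega))
  · intro i hi i' hi' h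
    have h1 := lv_val hq b (i := T - lam + i) (by omega)
    have h2 := lv_val hq b (i := T - lam + i') (by omega)
    simp only at h
    rw [h, h2] at h1
    omega
  · intro i hi
    exact lv_adj hq pos b (by omega)
  · rintro ⟨c, x⟩ ((⟨h1, h2, h3⟩ | h1) | ⟨h1, h2, h3⟩)
    · apply Finset.mem_insert.2
      left
      simp only at h1 h2 h3
      exact Prod.ext h1 (hin x (by omega) (by omega))
    · exact Finset.mem_insert_of_mem h1
    · apply Finset.mem_insert.2
      left
      simp only at h1 h2 h3
      exact Prod.ext h1 (hin x (by omega) (by omega))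
  · intro i hi
    have h0 := lv_val hq b (i := T - lam + i) (by omega)
    beta_reduce
    rintro ((⟨h1, h2, h3⟩ | h1) | ⟨h1, h2, h3⟩)
    · omega
    · apply hbK
      have := hin (lv q hq b (T - lam + i)).2 (by omega) (by omega)
      rw [← this]
      exact h1
    · omega
  · refine ⟨lv q hq b (T - lam - 1), Or.inl (Or.inl ⟨rfl, ?_⟩), ?_⟩
    · rw [lv_val hq b (by omega)]; omega
    · have := lv_adj hq pos b (i := T - lam - 1) (by omega)
      rwa [show T - lam - 1 + 1 = T - lam + 0 by omega] at this
  · refine ⟨lv q hq b T, Or.inr ⟨rfl, ?_⟩, ?_⟩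
    · rw [lv_val hq b (by omega)]; omega
    · have := lv_adj hq pos b (i := T - lam + (lam - 1)) (by omega)
      rwa [show T - lam + (lam - 1) + 1 = T by omega] at this


/-! ### Packing certificates in the ladder -/

/-- `B` is a union of blocks of length `L`. -/
def Aligned {q : ℕ} (L : ℕ) (B : Finset (Bool × Fin q)) : Prop :=
  ∀ b (x y : Fin q), x.val / L = y.val / L → (b, x) ∈ B → (b, y) ∈ B

theorem fiber_card {q : ℕ} (e : Equiv.Perm (Fin q)) (J c : ℕ) (hJ : 0 < J) :
    (Finset.univ.filter (fun x : Fin q => (e x).val / J = c)).card ≤ J := by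
  calc _ ≤ (Finset.range J).card := by
        refine Finset.card_le_card_of_injOn (fun x => (e x).val % J) ?_ ?_
        · intro x _
          simpa using Nat.mod_lt _ hJ
        · intro x hx y hy hxy
          simp only [Finset.coe_filter, Finset.mem_univ, true_and, Set.mem_setOf_eq] at hx hy
          simp only at hxy
          apply e.injective
          apply Fin.ext
          rw [← Nat.div_add_mod (e x).val J, ← Nat.div_add_mod (e y).val J, hx, hy, hxy]
    _ = J := Finset.card_range J

theorem link_card {q N lam : ℕ} (hlam : 0 < lam) (hq : q = 16 * lam * N) (e : Equiv.Perm (Fin q)) :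
    (Finset.univ.filter (fun x : Fin q => ¬ (e x).val % (16 * lam) < 15 * lam)).card ≤ N * lam := by
  calc _ ≤ (Finset.range N ×ˢ Finset.range lam).card := by
        refine Finset.card_le_card_of_injOn
          (fun x => ((e x).val / (16 * lam), (e x).val % (16 * lam) - 15 * lam)) ?_ ?_
        · intro x hx
          simp only [Finset.coe_filter, Finset.mem_univ, true_and, Set.mem_setOf_eq] at hx
          simp only [Finset.coe_product, Finset.coe_range, Set.mem_prod, Set.mem_Iio]
          have := Nat.mod_lt (e x).val (show 0 < 16 * lam by omega)
          refine ⟨?_, by omega⟩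
          rw [Nat.div_lt_iff_lt_mul (by omega), mul_comm, ← hq]
          exact (e x).2
        · intro x hx y hy hxy
          simp only [Finset.coe_filter, Finset.mem_univ, true_and, Set.mem_setOf_eq] at hx hy
          simp only [Prod.mk.injEq] at hxy
          apply e.injective
          apply Fin.ext
          rw [← Nat.div_add_mod (e x).val (16 * lam), ← Nat.div_add_mod (e y).val (16 * lam), hxy.1]
          omega
    _ = N * lam := by simp

theorem pack_step {q N lam R : ℕ} (hlam : 0 < lam) (hN : 0 < N) (hqN : q = 16 * (16 * lam) * N)
    (hR : 2 * N < 2 ^ R)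
    (pos : Bool → Equiv.Perm (Fin q)) (U : Finset (Bool × Fin q)) (hU : 8 * U.card ≤ q)
    (hal : Aligned (16 * (16 * lam)) U) :
    ∃ B : Finset (Bool × Fin q), Aligned (16 * (16 * lam)) B ∧ (∀ z ∈ B, z ∉ U) ∧
      B.card ≤ (2 * R + 3) * (16 * (16 * lam)) ∧ Cert (Ladder q pos) lam {z | z ∈ B} := by
  classical
  have hJ0 : 0 < 16 * lam := by omega
  -- good chords
  let good : Finset (Fin q) := Finset.univ.filter
    (fun j => ∀ b, (b, pos b j) ∉ U ∧ (pos b j).val % (16 * lam) < 15 * lam)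
  have hgood : ∀ j, j ∈ good ↔ ∀ b, (b, pos b j) ∉ U ∧ (pos b j).val % (16 * lam) < 15 * lam := by
    intro j; simp [good]
  have hgc : 3 * q ≤ 4 * good.card := by
    let bad1 : Finset (Fin q) := U.image (fun z => (pos z.1).symm z.2)
    let bad2 : Bool → Finset (Fin q) := fun b =>
      Finset.univ.filter (fun x : Fin q => ¬ (pos b x).val % (16 * lam) < 15 * lam)
    have hb2 : ∀ b, (bad2 b).card ≤ 16 * N * lam := fun b =>
      link_card (N := 16 * N) hlam (by rw [hqN]; ring) (pos b)
    have hcov : (Finset.univ : Finset (Fin q)) ⊆ good ∪ (bad1 ∪ (bad2 true ∪ bad2 false)) := by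
      intro j _
      by_contra hcon
      simp only [Finset.mem_union, not_or] at hcon
      obtain ⟨h1, h2, h3, h4⟩ := hcon
      apply h1
      rw [hgood]
      intro b
      constructor
      · intro h
        exact h2 (Finset.mem_image.2 ⟨_, h, by simp⟩)
      · cases b
        · simpa [bad2] using h4
        · simpa [bad2] using h3
    have hc := Finset.card_le_card hcov
    have u1 := Finset.card_union_le good (bad1 ∪ (bad2 true ∪ bad2 false))
    have u2 := Finset.card_union_le bad1 (bad2 true ∪ bad2 false)
    have u3 := Finset.card_union_le (bad2 true) (bad2 false)
    have u4 : bad1.card ≤ U.card := Finset.card_image_le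
    have u5 := hb2 true
    have u6 := hb2 false
    simp only [Finset.card_univ, Fintype.card_fin] at hc
    have : q = 16 * (16 * N * lam) := by rw [hqN]; ring
    omega
  -- maximal independent set of chords
  let fam : Finset (Finset (Fin q)) := good.powerset.filter (fun M => ∀ j ∈ M, ∀ j' ∈ M, ∀ b,
    (pos b j).val / (16 * lam) = (pos b j').val / (16 * lam) → j = j')
  have hfam : ∀ M, M ∈ fam ↔ M ⊆ good ∧ ∀ j ∈ M, ∀ j' ∈ M, ∀ b,
    (pos b j).val / (16 * lam) = (pos b j').val / (16 * lam) → j = j' := by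
    intro M; simp [fam]
  obtain ⟨M, hM, hmax⟩ := Finset.exists_max_image fam Finset.card ⟨∅, by simp [fam]⟩
  rw [hfam] at hM
  obtain ⟨hMg, hMi⟩ := hM
  have hdom : ∀ g ∈ good, ∃ b, ∃ j ∈ M, (pos b g).val / (16 * lam) = (pos b j).val / (16 * lam) := by
    intro g hg
    by_contra hcon
    push Not at hcon
    have hgM : g ∉ M := fun h => hcon true g h rfl
    have := hmax (insert g M) (by
      rw [hfam]
      refine ⟨Finset.insert_subset hg hMg, ?_⟩
      intro j hj j' hj' b h
      rw [Finset.mem_insert] at hj hj'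
      rcases hj with rfl | hj <;> rcases hj' with rfl | hj'
      · rfl
      · exact absurd h (hcon b j' hj')
      · exact absurd h.symm (hcon b j hj)
      · exact hMi j hj j' hj' b h)
    rw [Finset.card_insert_of_notMem hgM] at this
    omega
  have hMc : good.card ≤ 2 * M.card * (16 * lam) := by
    have hsub : good ⊆ (Finset.univ ×ˢ M).biUnion (fun z : Bool × Fin q =>
        Finset.univ.filter (fun x : Fin q =>
          (pos z.1 x).val / (16 * lam) = (pos z.1 z.2).val / (16 * lam))) := by
      intro g hg
      obtain ⟨b, j, hj, h⟩ := hdom g hg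
      rw [Finset.mem_biUnion]
      exact ⟨(b, j), by simp [hj], by simp [h]⟩
    refine (Finset.card_le_card hsub).trans ?_
    refine (Finset.card_biUnion_le_card_mul _ _ (16 * lam) ?_).trans ?_
    · intro z _
      exact fiber_card (pos z.1) _ _ hJ0
    · simp [Finset.card_product]
  have hMN : 6 * N ≤ M.card := by
    have h1 : 3 * (16 * (16 * lam) * N) ≤ 4 * (2 * M.card * (16 * lam)) := by
      rw [← hqN]; omega
    have h2 : (6 * N) * (128 * lam) ≤ M.card * (128 * lam) := by nlinarith
    exact Nat.le_of_mul_le_mul_right h2 (by omega)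
  -- block index
  let dv : Fin q → Fin N := fun x => ⟨x.val / (16 * (16 * lam)), by
    rw [Nat.div_lt_iff_lt_mul (by omega), mul_comm, ← hqN]
    exact x.2⟩
  have hdv : ∀ x, (dv x).val = x.val / (16 * (16 * lam)) := fun x => rfl
  obtain ⟨M', hM'M, hne, hdeg⟩ := exists_mindeg_three (fun b j => dv (pos b j)) _ M rfl (by
    have := Finset.card_le_univ ((Finset.univ ×ˢ M).image
      (fun z : Bool × Fin q => (z.1, dv (pos z.1 z.2))))
    simp only [Fintype.card_prod, Fintype.card_bool, Fintype.card_fin] at this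
    omega)
  obtain ⟨b, j, j', K, hj, hj', hjj, hf, hbK, hjK, hjK', hK, hKt, hKc⟩ :=
    exists_handle (R := R) (fun b j => dv (pos b j)) M' hne hdeg hR
  beta_reduce at hf hbK hjK hjK' hKt
  have hgj := (hgood j).1 (hMg (hM'M hj))
  have hgj' := (hgood j').1 (hMg (hM'M hj'))
  have hoff := (hgj b).2
  have hoff' := (hgj' b).2
  let B : Finset (Bool × Fin q) :=
    Finset.univ.filter (fun z => (z.1, dv z.2) ∈ insert (b, dv (pos b j)) K)
  have hB : ∀ z, z ∈ B ↔ (z.1, dv z.2) ∈ insert (b, dv (pos b j)) K := by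
    intro z; simp only [B, Finset.mem_filter, Finset.mem_univ, true_and]
  have hcert : Cert (Ladder q pos) lam {z | z ∈ B} := by
    have hset : {z | z ∈ B} = {z : Bool × Fin q | (z.1, dv z.2) ∈ insert (b, dv (pos b j)) K} := by
      ext z; exact hB z
    rw [hset]
    rcases lt_trichotomy ((pos b j).val / (16 * lam)) ((pos b j').val / (16 * lam)) with h | h | h
    · exact cert_of_handle hlam hqN pos dv hdv M' b j j' K hoff h hf hbK hjK hjK' hK
    · exact absurd (hMi j (hM'M hj) j' (hM'M hj') b h) hjj
    · rw [hf] at hbK ⊢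
      exact cert_of_handle hlam hqN pos dv hdv M' b j' j K hoff' h hf.symm hbK hjK' hjK hK
  refine ⟨B, ?_, ?_, ?_, hcert⟩
  · intro c x y hxy h
    rw [hB] at h ⊢
    have : dv x = dv y := Fin.ext hxy
    simp only at h ⊢
    rwa [← this]
  · rintro ⟨c, x⟩ h hx
    rw [hB] at h
    have key : ∀ i ∈ M', dv (pos c i) = dv x → False := by
      intro i hi h
      exact ((hgood i).1 (hMg (hM'M hi)) c).1 (hal c x _ (Fin.ext_iff.1 h.symm) hx)
    rcases Finset.mem_insert.1 h with h | h
    · rw [Prod.mk.injEq] at h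
      obtain ⟨rfl, h⟩ := h
      exact key j hj h.symm
    · obtain ⟨i, hi, h⟩ := hKt _ h
      exact key i hi h
  · have hsub : B ⊆ (insert (b, dv (pos b j)) K).biUnion (fun v =>
        (Finset.univ.filter (fun x : Fin q => x.val / (16 * (16 * lam)) = v.2.val)).image
          (fun x => (v.1, x))) := by
      rintro ⟨c, x⟩ h
      rw [hB] at h
      rw [Finset.mem_biUnion]
      exact ⟨_, h, Finset.mem_image.2 ⟨x, by simp [hdv], rfl⟩⟩
    refine (Finset.card_le_card hsub).trans ?_
    refine (Finset.card_biUnion_le_card_mul _ _ (16 * (16 * lam)) ?_).trans ?_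
    · intro v _
      exact Finset.card_image_le.trans (fiber_card (Equiv.refl _) _ _ (by omega))
    · apply Nat.mul_le_mul_right
      have := Finset.card_insert_le (b, dv (pos b j)) K
      omega

theorem pack {Q : ℕ} (pos : Bool → Equiv.Perm (Fin (2 ^ Q))) {ι : Type} [DecidableEq ι]
    (m : ι → ℕ) (s : Finset ι) :
    (∀ i ∈ s, m i + 8 ≤ Q) → 8 * ∑ i ∈ s, (2 * Q + 3) * 2 ^ (m i + 8) ≤ 2 ^ Q →
    ∃ B : ι → Finset (Bool × Fin (2 ^ Q)), (∀ i ∈ s, Aligned (2 ^ (m i + 8)) (B i)) ∧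
      (∀ i ∈ s, (B i).card ≤ (2 * Q + 3) * 2 ^ (m i + 8)) ∧
      (∀ i ∈ s, Cert (Ladder (2 ^ Q) pos) (2 ^ m i) {z | z ∈ B i}) ∧
      (∀ i ∈ s, ∀ j ∈ s, ∀ z, z ∈ B i → z ∈ B j → i = j) := by
  induction s using Finset.induction_on_min_value m with
  | empty => intro _ _; exact ⟨fun _ => ∅, by simp, by simp, by simp, by simp⟩
  | insert a s has hmin ih =>
    intro hm hsum
    rw [Finset.sum_insert has] at hsum
    obtain ⟨B, h1, h2, h3, h4⟩ := ih (fun i hi => hm i (Finset.mem_insert_of_mem hi)) (by omega)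
    have hma := hm a (Finset.mem_insert_self _ _)
    have hL : 2 ^ (m a + 8) = 16 * (16 * 2 ^ m a) := by rw [pow_add]; ring
    have hQ : 2 ^ Q = 16 * (16 * 2 ^ m a) * 2 ^ (Q - (m a + 8)) := by
      rw [← hL, ← pow_add]; congr 1; omega
    obtain ⟨B', g1, g2, g3, g4⟩ := pack_step (N := 2 ^ (Q - (m a + 8))) (lam := 2 ^ m a) (R := Q)
      (by positivity) (by positivity) hQ
      (by
        calc 2 * 2 ^ (Q - (m a + 8)) = 2 ^ (Q - (m a + 8) + 1) := by ring
          _ < 2 ^ Q := Nat.pow_lt_pow_right (by omega) (by omega))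
      pos (s.biUnion B)
      (by
        have c1 : (s.biUnion B).card ≤ ∑ i ∈ s, (2 * Q + 3) * 2 ^ (m i + 8) :=
          Finset.card_biUnion_le.trans (Finset.sum_le_sum h2)
        omega)
      (by
        intro b x y hxy hx
        rw [Finset.mem_biUnion] at hx ⊢
        obtain ⟨i, hi, hx⟩ := hx
        refine ⟨i, hi, h1 i hi b x y ?_ hx⟩
        have hle := hmin i hi
        have e : 2 ^ (m i + 8) = 16 * (16 * 2 ^ m a) * 2 ^ (m i - m a) := by
          rw [← hL, ← pow_add]; congr 1; omega
        rw [e, ← Nat.div_div_eq_div_mul, hxy, Nat.div_div_eq_div_mul])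
    have hB'i : ∀ i ∈ s, ∀ z, z ∈ B' → z ∈ B i → False := fun i hi z hz hz' =>
      g2 z hz (Finset.mem_biUnion.2 ⟨i, hi, hz'⟩)
    have hne : ∀ i ∈ s, i ≠ a := fun i hi h => has (h ▸ hi)
    refine ⟨Function.update B a B', ?_, ?_, ?_, ?_⟩
    · intro i hi
      rcases Finset.mem_insert.1 hi with rfl | hi
      · rw [Function.update_self, hL]; exact g1
      · rw [Function.update_of_ne (hne i hi)]; exact h1 i hi
    · intro i hi
      rcases Finset.mem_insert.1 hi with rfl | hi
      · rw [Function.update_self, hL]; exact g3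
      · rw [Function.update_of_ne (hne i hi)]; exact h2 i hi
    · intro i hi
      rcases Finset.mem_insert.1 hi with rfl | hi
      · rw [Function.update_self]; exact g4
      · rw [Function.update_of_ne (hne i hi)]; exact h3 i hi
    · intro i hi j hj z hz hz'
      rcases Finset.mem_insert.1 hi with rfl | hi' <;> rcases Finset.mem_insert.1 hj with rfl | hj'
      · rfl
      · rw [Function.update_self] at hz
        rw [Function.update_of_ne (hne j hj')] at hz'
        exact (hB'i j hj' z hz hz').elim
      · rw [Function.update_self] at hz'
        rw [Function.update_of_ne (hne i hi')] at hz
        exact (hB'i i hi' z hz' hz).elim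
      · rw [Function.update_of_ne (hne i hi')] at hz
        rw [Function.update_of_ne (hne j hj')] at hz'
        exact h4 i hi' j hj' z hz hz'


/-! ### From certificates to the minor -/

theorem Cert.cycle {V : Type} {G : SimpleGraph V} {lam l : ℕ} {B : Set V} (h : Cert G lam B)
    (hl : 2 ≤ l) (hlam : l ≤ lam) :
    ∃ ψ : ℕ → Set V, (∀ t < l, SConn G (ψ t)) ∧ (∀ t < l, ψ t ⊆ B) ∧
      (∀ t < l, ∀ t' < l, ∀ x, x ∈ ψ t → x ∈ ψ t' → t = t') ∧
      (∀ t, t + 1 < l → ∃ u ∈ ψ t, ∃ v ∈ ψ (t + 1), G.Adj u v) ∧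
      (∃ u ∈ ψ (l - 1), ∃ v ∈ ψ 0, G.Adj u v) := by
  obtain ⟨p, K, hpB, hinj, hadj, hKB, hK, hpK, ⟨u₀, hu₀, hu₀p⟩, ⟨u₁, hu₁, hu₁p⟩⟩ := h
  let E : Set V := {x | ∃ i, l - 1 ≤ i ∧ i ≤ lam - 1 ∧ p i = x} ∪ K
  have hE : SConn G E := by
    refine (SConn.chain p (l - 1) (lam - 1) (by omega)
      (fun i _ hi => hadj i (by omega))).union hK (Or.inr ⟨p (lam - 1), ?_, u₁, hu₁, hu₁p⟩)
    exact ⟨lam - 1, by omega, le_rfl, rfl⟩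
  have hEp : ∀ t, t + 1 < l → p t ∉ E := by
    rintro t ht (⟨i, h1, h2, h3⟩ | h)
    · have := hinj i (by omega) t (by omega) h3
      omega
    · exact hpK t (by omega) h
  let ψ : ℕ → Set V := fun t => if t + 1 < l then {p t} else E
  have h1 : ∀ t, t + 1 < l → ψ t = {p t} := fun t ht => if_pos ht
  have h2 : ∀ t, ¬ t + 1 < l → ψ t = E := fun t ht => if_neg ht
  refine ⟨ψ, ?_, ?_, ?_, ?_, ?_⟩
  · intro t ht
    by_cases h : t + 1 < l
    · rw [h1 t h]; exact SConn.singleton _ _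
    · rw [h2 t h]; exact hE
  · intro t ht
    by_cases h : t + 1 < l
    · rw [h1 t h]
      rintro x rfl
      exact hpB t (by omega)
    · rw [h2 t h]
      rintro x (⟨i, _, h2, rfl⟩ | h)
      · exact hpB i (by omega)
      · exact hKB h
  · intro t ht t' ht' x hx hx'
    by_cases h : t + 1 < l <;> by_cases h' : t' + 1 < l
    · rw [h1 t h] at hx
      rw [h1 t' h'] at hx'
      exact hinj t (by omega) t' (by omega) (hx.symm.trans hx')
    · rw [h1 t h] at hx
      rw [h2 t' h'] at hx'
      exact absurd (hx ▸ hx') (hEp t h)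
    · rw [h2 t h] at hx
      rw [h1 t' h'] at hx'
      exact absurd (hx' ▸ hx) (hEp t' h')
    · omega
  · intro t ht
    rw [h1 t ht]
    by_cases h : t + 1 + 1 < l
    · rw [h1 _ h]
      exact ⟨_, rfl, _, rfl, hadj t (by omega)⟩
    · rw [h2 _ h]
      exact ⟨_, rfl, p (t + 1), Or.inl ⟨t + 1, by omega, by omega, rfl⟩, hadj t (by omega)⟩
  · rw [h2 (l - 1) (by omega), h1 0 (by omega)]
    exact ⟨u₀, Or.inr hu₀, _, rfl, hu₀p⟩

theorem exists_size {n : ℕ} (hn : 3 ≤ n) : ∃ Q : ℕ,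
    8 * ((2 * Q + 3) * 2 ^ 8 * (2 * n)) ≤ 2 ^ Q ∧
    (2 ^ Q : ℝ) ≤ 2 ^ 21 * n * (Real.logb 2 n) ^ 2 := by
  set t := Nat.clog 2 n with ht
  set u := Nat.clog 2 t with hu
  have h1 : n ≤ 2 ^ t := Nat.le_pow_clog (by omega) n
  have h2 : t ≤ 2 ^ u := Nat.le_pow_clog (by omega) t
  have h3 : 2 ^ (t - 1) < n := Nat.pow_pred_clog_lt_self (by omega) (by omega)
  have ht2 : 2 ≤ t := by
    by_contra hcon
    have : 2 ^ t ≤ 2 ^ 1 := Nat.pow_le_pow_right (by omega) (by omega)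
    omega
  have h4 : 2 ^ (u - 1) < t := Nat.pow_pred_clog_lt_self (by omega) (by omega)
  have hu1 : 1 ≤ u := by
    by_contra hcon
    have : u = 0 := by omega
    rw [this] at h2
    omega
  have e1 : 2 ^ t = 2 * 2 ^ (t - 1) := by rw [← pow_succ']; congr 1; omega
  have e2 : 2 ^ u = 2 * 2 ^ (u - 1) := by rw [← pow_succ']; congr 1; omega
  have hu2 : u < 2 ^ u := Nat.lt_two_pow_self
  refine ⟨t + u + 18, ?_, ?_⟩
  · have a1 : 2 * (t + u + 18) + 3 ≤ 43 * 2 ^ u := by omega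
    calc 8 * ((2 * (t + u + 18) + 3) * 2 ^ 8 * (2 * n))
        ≤ 8 * ((43 * 2 ^ u) * 2 ^ 8 * (2 * 2 ^ t)) := by gcongr
      _ = (43 * 2 ^ 12) * (2 ^ t * 2 ^ u) := by ring
      _ ≤ 2 ^ 18 * (2 ^ t * 2 ^ u) := by gcongr; norm_num
      _ = 2 ^ (t + u + 18) := by ring
  · have hnR : (3 : ℝ) ≤ n := by exact_mod_cast hn
    have l1 : 1 ≤ Real.logb 2 n := by
      rw [Real.le_logb_iff_rpow_le (by norm_num) (by linarith)]
      norm_num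
      linarith
    have l2 : (t : ℝ) - 1 ≤ Real.logb 2 n := by
      rw [Real.le_logb_iff_rpow_le (by norm_num) (by linarith)]
      have : ((t : ℝ) - 1) = ((t - 1 : ℕ) : ℝ) := by
        rw [Nat.cast_sub (by omega)]; simp
      rw [this, Real.rpow_natCast]
      exact_mod_cast h3.le
    have a1 : (2 ^ t : ℝ) ≤ 2 * n := by
      have : 2 ^ t ≤ 2 * n := by omega
      exact_mod_cast this
    have a2 : (2 ^ u : ℝ) ≤ 2 * t := by
      have : 2 ^ u ≤ 2 * t := by omega
      exact_mod_cast this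
    have a3 : (2 ^ u : ℝ) ≤ 4 * (Real.logb 2 n) ^ 2 := by nlinarith
    calc (2 ^ (t + u + 18) : ℝ) = 2 ^ 18 * (2 ^ t * 2 ^ u) := by ring
      _ ≤ 2 ^ 18 * ((2 * n) * (4 * (Real.logb 2 n) ^ 2)) := by gcongr
      _ = _ := by ring


theorem walk_edge_getVert {W : Type} {H : SimpleGraph W} {a b : W} (p : H.Walk a b) (w w' : W)
    (h : s(w, w') ∈ p.edges) : ∃ t < p.length, (p.getVert t = w ∧ p.getVert (t + 1) = w') ∨
      (p.getVert t = w' ∧ p.getVert (t + 1) = w) := by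
  obtain ⟨t, ht, h⟩ := List.getElem_of_mem h
  rw [Walk.getElem_edges] at h
  rw [Walk.length_edges] at ht
  exact ⟨t, ht, by simpa using h⟩

theorem cycles_minor {W V : Type} [Fintype W] {H : SimpleGraph W} {G : SimpleGraph V} {r : ℕ}
    (f : Fin r → Σ v, H.Walk v v) (hcyc : ∀ i, (f i).2.IsCycle)
    (hdisj : ∀ i j, i ≠ j → ∀ x ∈ (f i).2.support, x ∉ (f j).2.support)
    (hcov : ∀ w : W, ∃ i, w ∈ (f i).2.support)
    (hedge : ∀ e ∈ H.edgeSet, ∃ i, e ∈ (f i).2.edges)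
    (lam : Fin r → ℕ) (hlam : ∀ i, (f i).2.length ≤ lam i) (B : Fin r → Set V)
    (hB : ∀ i, Cert G (lam i) (B i)) (hBd : ∀ i j z, z ∈ B i → z ∈ B j → i = j) : MinorS H G := by
  have h3 : ∀ i, 3 ≤ (f i).2.length := fun i => (hcyc i).three_le_length
  have hψ := fun i => (hB i).cycle (l := (f i).2.length) (by have := h3 i; omega) (hlam i)
  choose ψ c1 c2 c3 c4 c5 using hψ
  choose I hI using hcov
  have hT : ∀ w, ∃ t, t < (f (I w)).2.length ∧ (f (I w)).2.getVert t = w := by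
    intro w
    obtain ⟨t, h1, h2⟩ := Walk.mem_support_iff_exists_getVert.1 (hI w)
    have := h3 (I w)
    by_cases h : t = (f (I w)).2.length
    · refine ⟨0, by omega, ?_⟩
      rw [h, Walk.getVert_length] at h1
      rw [Walk.getVert_zero, h1]
    · exact ⟨t, by omega, h1⟩
  choose T hTl hT using hT
  have hIu : ∀ w i, w ∈ (f i).2.support → I w = i := by
    intro w i hw
    by_contra hne
    exact hdisj _ _ hne w (hI w) hw
  have hTu : ∀ w i t, t < (f i).2.length → (f i).2.getVert t = w → I w = i ∧ T w = t := by
    intro w i t ht hw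
    have h1 := hIu w i (hw ▸ Walk.getVert_mem_support _ _)
    subst h1
    refine ⟨rfl, ?_⟩
    have a1 := hTl w
    exact (hcyc (I w)).getVert_injOn' (by simp only [Set.mem_setOf_eq]; omega)
      (by simp only [Set.mem_setOf_eq]; omega) ((hT w).trans hw.symm)
  refine ⟨fun w => ψ (I w) (T w), fun w => c1 _ _ (hTl w), ?_, ?_⟩
  · intro w w' x hx hx'
    have h1 := hBd _ _ x (c2 _ _ (hTl w) hx) (c2 _ _ (hTl w') hx')
    have h2 : T w = T w' := by
      refine c3 (I w) _ (hTl w) _ ?_ x hx ?_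
      · rw [h1]; exact hTl w'
      · rw [h1]; exact hx'
    rw [← hT w, ← hT w', h2, h1]
  · have key : ∀ w w' i t, t < (f i).2.length → (f i).2.getVert t = w →
        (f i).2.getVert (t + 1) = w' → ∃ u ∈ ψ (I w) (T w), ∃ v ∈ ψ (I w') (T w'), G.Adj u v := by
      intro w w' i t ht h1 h2
      obtain ⟨e1, e2⟩ := hTu w i t ht h1
      have := h3 i
      by_cases h : t + 1 < (f i).2.length
      · obtain ⟨e3, e4⟩ := hTu w' i (t + 1) h h2
        rw [e1, e2, e3, e4]
        exact c4 i t h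
      · have h' : t + 1 = (f i).2.length := by omega
        rw [h', Walk.getVert_length] at h2
        obtain ⟨e3, e4⟩ := hTu w' i 0 (by omega) (by rw [Walk.getVert_zero, h2])
        rw [e1, e2, e3, e4, show t = (f i).2.length - 1 by omega]
        exact c5 i
    intro w w' hww
    obtain ⟨i, hi⟩ := hedge s(w, w') hww
    obtain ⟨t, ht, ⟨h1, h2⟩ | ⟨h1, h2⟩⟩ := walk_edge_getVert _ _ _ hi
    · exact key w w' i t ht h1 h2
    · obtain ⟨u, hu, v, hv, huv⟩ := key w' w i t ht h1 h2
      exact ⟨v, hv, u, hu, huv.symm⟩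

theorem sum_lengths {W : Type} [Fintype W] {H : SimpleGraph W} {r : ℕ}
    (f : Fin r → Σ v, H.Walk v v) (hcyc : ∀ i, (f i).2.IsCycle)
    (hdisj : ∀ i j, i ≠ j → ∀ x ∈ (f i).2.support, x ∉ (f j).2.support) :
    ∑ i, (f i).2.length ≤ Fintype.card W := by
  have := Fintype.card_le_of_injective
    (fun z : Σ i : Fin r, Fin (f i).2.length => (f z.1).2.getVert z.2.val) (by
      rintro ⟨i, s⟩ ⟨j, t⟩ h
      simp only at h
      have hij : i = j := by
        by_contra hne
        exact hdisj i j hne _ (Walk.getVert_mem_support _ s.val)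
          (h ▸ Walk.getVert_mem_support _ t.val)
      subst hij
      have hs := s.2
      have ht := t.2
      have := (hcyc i).getVert_injOn' (by simp only [Set.mem_setOf_eq]; omega)
        (by simp only [Set.mem_setOf_eq]; omega) h
      rw [Fin.ext this])
  simpa using this

/-- For some absolute constant `c`, every graph of treewidth at least
`c·|V(H)|·(log₂ |V(H)|)²` contains a given disjoint union of cycles `H` as a minor. -/
theorem stmt_9 :
    ∃ c : ℝ, 0 < c ∧
      ∀ (W V : Type) (_ : Fintype W) (_ : Fintype V)
        (H : SimpleGraph W) (G : SimpleGraph V),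
        (∃ r : ℕ, IsDisjointUnionOfCycles H r (Fintype.card W)) →
        c * (Fintype.card W) * (Real.logb 2 (Fintype.card W)) ^ 2 ≤ (treewidth G : ℝ) →
        IsMinor H G := by
  refine ⟨27 * 2 ^ 21, by norm_num, ?_⟩
  intro W V _ _ H G ⟨r, f, hlen, hdisj, hcov, hedge⟩ htw
  classical
  have hcyc : ∀ i, (f i).2.IsCycle := fun i => (hlen i).1
  rcases isEmpty_or_nonempty W with hW | ⟨⟨w₀⟩⟩
  · exact ⟨fun w => hW.elim w, fun w => hW.elim w, fun w => hW.elim w, fun w => hW.elim w⟩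
  have hsum := sum_lengths f hcyc hdisj
  set n := Fintype.card W with hn
  have hli : ∀ i, (f i).2.length ≤ n := fun i => (hlen i).2
  have hn3 : 3 ≤ n := by
    obtain ⟨i, -⟩ := hcov w₀
    exact (hcyc i).three_le_length.trans (hli i)
  obtain ⟨Q, hQ1, hQ2⟩ := exists_size hn3
  have hq : 0 < 2 ^ Q := by positivity
  have htw' : 9 * (3 * 2 ^ Q) ≤ treewidth G := by
    have : ((9 * (3 * 2 ^ Q) : ℕ) : ℝ) ≤ (treewidth G : ℝ) := by
      refine le_trans ?_ htw
      push_cast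
      linarith
    exact_mod_cast this
  obtain ⟨β, hβ⟩ := exists_haven G (3 * 2 ^ Q) (by omega) htw'
  obtain ⟨v₁, w₁, P₁, v₂, w₂, P₂, hP₁, hP₂, hPd, hL⟩ := hβ.two_paths hq
  obtain ⟨pos, hminor⟩ := ladder_minor hP₁ hP₂ hPd hL
  let m : Fin r → ℕ := fun i => Nat.clog 2 (f i).2.length
  have hm1 : ∀ i, (f i).2.length ≤ 2 ^ m i := fun i => Nat.le_pow_clog (by omega) _
  have hm2 : ∀ i, 2 ^ m i ≤ 2 * (f i).2.length := by
    intro i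
    have h3 := (hcyc i).three_le_length
    have h4 : 2 ^ (m i - 1) < (f i).2.length := Nat.pow_pred_clog_lt_self (by omega) (by omega)
    have h5 : 2 ^ m i ≤ 2 * 2 ^ (m i - 1) := by
      rw [← pow_succ']
      exact Nat.pow_le_pow_right (by omega) (by omega)
    omega
  have hm3 : ∀ i ∈ (Finset.univ : Finset (Fin r)), m i + 8 ≤ Q := by
    intro i _
    rw [← Nat.pow_le_pow_iff_right (a := 2) (by omega)]
    refine le_trans ?_ hQ1
    have h1 := hm2 i
    have h2 := hli i
    calc 2 ^ (m i + 8) = 2 ^ m i * 2 ^ 8 := by ring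
      _ ≤ (2 * n) * 2 ^ 8 := by gcongr; omega
      _ ≤ (8 * (2 * Q + 3)) * ((2 * n) * 2 ^ 8) := Nat.le_mul_of_pos_left _ (by omega)
      _ = _ := by ring
  have hm4 : 8 * ∑ i ∈ (Finset.univ : Finset (Fin r)), (2 * Q + 3) * 2 ^ (m i + 8) ≤ 2 ^ Q := by
    refine le_trans ?_ hQ1
    apply Nat.mul_le_mul_left
    calc ∑ i, (2 * Q + 3) * 2 ^ (m i + 8)
        ≤ ∑ i, (2 * Q + 3) * 2 ^ 8 * 2 * (f i).2.length := by
          apply Finset.sum_le_sum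
          intro i _
          calc (2 * Q + 3) * 2 ^ (m i + 8) = (2 * Q + 3) * 2 ^ 8 * 2 ^ m i := by ring
            _ ≤ (2 * Q + 3) * 2 ^ 8 * (2 * (f i).2.length) := Nat.mul_le_mul_left _ (hm2 i)
            _ = _ := by ring
      _ = (2 * Q + 3) * 2 ^ 8 * 2 * ∑ i, (f i).2.length := by rw [Finset.mul_sum]
      _ ≤ (2 * Q + 3) * 2 ^ 8 * 2 * n := Nat.mul_le_mul_left _ hsum
      _ = _ := by ring
  obtain ⟨B, -, -, hcert, hBd⟩ := pack pos m Finset.univ hm3 hm4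
  have hH := cycles_minor f hcyc hdisj hcov hedge (fun i => 2 ^ m i) hm1 (fun i => {z | z ∈ B i})
    (fun i => hcert i (Finset.mem_univ _))
    (fun i j z hz hz' => hBd i (Finset.mem_univ _) j (Finset.mem_univ _) z hz hz')
  exact (hH.trans hminor).isMinor
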